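/- arXiv:2108.07475 — 2 statements merged into one kernel-verified Lean document; each statement's English description precedes it below -/
import Mathlib

section
/- Let c > 0 and let L be an affine map of ℂ², i.e. L(x,y) = (a₁x + a₂y + a₃, b₁x + b₂y + b₃), with L(Ω_c) = Ω_c. Then there exists e ∈ ℂ with e^{d²−1} = 1 such that L(x,y) = (e·x, e^d·y) for all (x,y), and moreover p(e^d·z) = e·p(z) for all z ∈ ℂ. In particular, the affine maps of ℂ² preserving Ω_c form a finite cyclic group under composition (a subgroup of the cyclic group of order d² − 1). -/
open Filter Topology Set

noncomputable section

/-- `L : ℂ² → ℂ²` is an affine map. -/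
def IsAffine (L : ℂ × ℂ → ℂ × ℂ) : Prop :=
  ∃ a₁ a₂ a₃ b₁ b₂ b₃ : ℂ, ∀ z : ℂ × ℂ,
    L z = (a₁ * z.1 + a₂ * z.2 + a₃, b₁ * z.1 + b₂ * z.2 + b₃)

lemma poly_bound (d : ℕ) (hd : 2 ≤ d) (p : Polynomial ℂ) (hpm : p.Monic) (hpd : p.natDegree = d)
    (hpc : p.coeff (d - 1) = 0) :
    ∃ A : ℝ, 0 ≤ A ∧ ∀ y : ℂ, 1 ≤ ‖y‖ → ‖p.eval y - y ^ d‖ ≤ A * ‖y‖ ^ (d - 2) := by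
  obtain ⟨k, rfl⟩ : ∃ k, d = k + 2 := ⟨d - 2, by omega⟩
  refine ⟨∑ i ∈ Finset.range (k + 1), ‖p.coeff i‖, Finset.sum_nonneg fun _ _ => norm_nonneg _, ?_⟩
  intro y hy
  have h1 : p.coeff (k + 2) = 1 := by rw [← hpd]; exact hpm
  have h2 : p.coeff (k + 1) = 0 := by simpa using hpc
  rw [Polynomial.eval_eq_sum_range, hpd, Finset.sum_range_succ, Finset.sum_range_succ, h1, h2]
  have : (∑ i ∈ Finset.range (k + 1), p.coeff i * y ^ i + 0 * y ^ (k + 1) + 1 * y ^ (k + 2)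
      - y ^ (k + 2)) = ∑ i ∈ Finset.range (k + 1), p.coeff i * y ^ i := by ring
  rw [this, Finset.sum_mul]
  refine norm_sum_le_of_le _ fun i hi => ?_
  rw [norm_mul, norm_pow]
  have := Finset.mem_range.1 hi
  gcongr
  omega

/-- One step estimate. -/
lemma step_est (d : ℕ) (hd : 2 ≤ d) (a : ℂ) (p : Polynomial ℂ) (A : ℝ) (hA : 0 ≤ A)
    (hp : ∀ y : ℂ, 1 ≤ ‖y‖ → ‖p.eval y - y ^ d‖ ≤ A * ‖y‖ ^ (d - 2))
    (x y : ℂ) (hy : 1 ≤ ‖y‖) (hE : (A + ‖a‖ * ‖x‖) / ‖y‖ ^ 2 ≤ 1 / 2) :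
    ‖y‖ ^ 2 / 2 ≤ ‖p.eval y - a * x‖ ∧
    |Real.log ‖p.eval y - a * x‖ - d * Real.log ‖y‖| ≤ 2 * ((A + ‖a‖ * ‖x‖) / ‖y‖ ^ 2) := by
  set E := (A + ‖a‖ * ‖x‖) / ‖y‖ ^ 2 with hEdef
  have hy0 : 0 < ‖y‖ := by linarith
  have hE0 : 0 ≤ E := by positivity
  have hpow : ‖y‖ ^ d = ‖y‖ ^ (d - 2) * ‖y‖ ^ 2 := by rw [← pow_add]; congr 1; omega
  have hpow1 : 1 ≤ ‖y‖ ^ (d - 2) := one_le_pow₀ hy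
  have hyd : 0 < ‖y‖ ^ d := by positivity
  have key : ‖(p.eval y - a * x) - y ^ d‖ ≤ E * ‖y‖ ^ d := by
    have e1 : (p.eval y - a * x) - y ^ d = (p.eval y - y ^ d) - a * x := by ring
    have e2 : E * ‖y‖ ^ d = (A + ‖a‖ * ‖x‖) * ‖y‖ ^ (d - 2) := by
      rw [hEdef, hpow]; field_simp
    rw [e1, e2]
    calc _ ≤ ‖p.eval y - y ^ d‖ + ‖a * x‖ := norm_sub_le _ _
      _ ≤ A * ‖y‖ ^ (d - 2) + ‖a‖ * ‖x‖ * ‖y‖ ^ (d - 2) := by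
        rw [norm_mul]
        have : 0 ≤ ‖a‖ * ‖x‖ := by positivity
        have := hp y hy
        nlinarith
      _ = _ := by ring
  set Y := p.eval y - a * x
  have hlow : (1 - E) * ‖y‖ ^ d ≤ ‖Y‖ := by
    have := norm_sub_norm_le (y ^ d) Y
    rw [norm_sub_rev (y ^ d) Y, norm_pow] at this
    linarith
  have hup : ‖Y‖ ≤ (1 + E) * ‖y‖ ^ d := by
    have := norm_sub_norm_le Y (y ^ d)
    rw [norm_pow] at this
    linarith
  have hYpos : 0 < ‖Y‖ := lt_of_lt_of_le (by apply mul_pos <;> linarith) hlow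
  constructor
  · have : ‖y‖ ^ 2 ≤ ‖y‖ ^ d := pow_le_pow_right₀ hy hd
    nlinarith
  · rw [← Real.log_pow, ← Real.log_div hYpos.ne' hyd.ne', abs_le]
    have h1 : 1 - E ≤ ‖Y‖ / ‖y‖ ^ d := by rwa [le_div_iff₀ hyd]
    have h2 : ‖Y‖ / ‖y‖ ^ d ≤ 1 + E := by rwa [div_le_iff₀ hyd]
    have hq : 0 < ‖Y‖ / ‖y‖ ^ d := by positivity
    constructor
    · have h3 := Real.one_sub_inv_le_log_of_pos hq
      have h4 : (‖Y‖ / ‖y‖ ^ d)⁻¹ ≤ (1 - E)⁻¹ := inv_anti₀ (by linarith) h1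
      have h5 : (1 - E)⁻¹ ≤ 1 + 2 * E := by
        rw [inv_le_iff_one_le_mul₀ (by linarith)]; nlinarith
      linarith
    · have := Real.log_le_sub_one_of_pos hq
      linarith

/-- the abstract comparison lemma -/
lemma compare (d : ℕ) (hd : 2 ≤ d) (c : ℝ) (g₁ g₂ : ℂ → ℝ) (hg₁ : Continuous g₁)
    (P Q : ℕ → ℂ → ℂ) (hP : ∀ n, Differentiable ℂ (P n)) (hQ : ∀ n, Differentiable ℂ (Q n))
    (hPa : ∀ R δ : ℝ, 0 < δ → ∃ n₀, ∀ n ≥ n₀, ∀ t, ‖t‖ ≤ R → c ≤ g₁ t →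
      P n t ≠ 0 ∧ |g₁ t - Real.log ‖P n t‖ / (d : ℝ) ^ n| ≤ δ)
    (hQa : ∀ R δ : ℝ, 0 < δ → ∃ n₀, ∀ n ≥ n₀, ∀ t, ‖t‖ ≤ R → c ≤ g₂ t →
      Q n t ≠ 0 ∧ |g₂ t - Real.log ‖Q n t‖ / (d : ℝ) ^ n| ≤ δ)
    (hiff : ∀ t, c ≤ g₁ t → c ≤ g₂ t)
    (k l : ℕ) (K : ℝ)
    (hk : ∀ᶠ t in Bornology.cobounded ℂ, |k * g₁ t - Real.log ‖t‖| ≤ K)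
    (hl : ∀ᶠ t in Bornology.cobounded ℂ, |l * g₂ t - Real.log ‖t‖| ≤ K)
    (t₀ : ℂ) (ht₀ : c ≤ g₁ t₀) : k * (g₁ t₀ - c) ≤ l * (g₂ t₀ - c) := by
  have hd0 : (0 : ℝ) < d := by exact_mod_cast (by omega : 0 < d)
  -- main claim
  have main : ∀ N : ℕ, (N : ℝ) * (k * (g₁ t₀ - c)) ≤ (N + 1) * (l * (g₂ t₀ - c)) := by
    intro N
    have h2 := hiff t₀ ht₀
    rcases ht₀.eq_or_lt with h | hlt
    · rw [← h]
      have : 0 ≤ g₂ t₀ - c := by linarith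
      simp only [sub_self, mul_zero]
      positivity
    -- choose radius
    have hlog : Tendsto (fun t : ℂ => Real.log ‖t‖) (Bornology.cobounded ℂ) atTop :=
      Real.tendsto_log_atTop.comp tendsto_norm_cobounded_atTop
    have hev : ∀ᶠ t in Bornology.cobounded ℂ,
        N * (k * (g₁ t - c)) - (N + 1) * (l * (g₂ t - c)) ≤ 0 := by
      filter_upwards [hk, hl, hlog.eventually_ge_atTop
        (N * K + (N + 1) * K - N * k * c + (N + 1) * l * c)] with t h1 h2 h3
      have h1' := (abs_le.1 h1).2
      have h2' := (abs_le.1 h2).1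
      have e1 : (N : ℝ) * (k * g₁ t) ≤ N * (K + Real.log ‖t‖) := by gcongr; linarith
      have e2 : ((N : ℝ) + 1) * (Real.log ‖t‖ - K) ≤ (N + 1) * (l * g₂ t) := by gcongr; linarith
      nlinarith
    obtain ⟨R₀, hR₀⟩ : ∃ R₀ : ℝ, ∀ t : ℂ, R₀ ≤ ‖t‖ →
        N * (k * (g₁ t - c)) - (N + 1) * (l * (g₂ t - c)) ≤ 0 := by
      obtain ⟨r, -, hr⟩ := (hasBasis_cobounded_norm (E := ℂ)).eventually_iff.1 hev
      exact ⟨r, fun t ht => hr ht⟩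
    set R := max R₀ (‖t₀‖ + 1) with hR
    have hRt : ‖t₀‖ < R := lt_of_lt_of_le (by linarith) (le_max_right _ _)
    set M : ℝ := N * k + (N + 1) * l with hM
    have hM0 : 0 ≤ M := by positivity
    -- reduce to epsilon
    suffices hs : ∀ δ : ℝ, 0 < δ →
        N * (k * (g₁ t₀ - c)) - (N + 1) * (l * (g₂ t₀ - c)) ≤ 2 * M * δ by
      by_contra hcon
      push Not at hcon
      set s := N * (k * (g₁ t₀ - c)) - (N + 1) * (l * (g₂ t₀ - c)) with hsdef
      have hs0 : 0 < s := by linarith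
      have := hs (s / (4 * (M + 1))) (by positivity)
      have h5 : 2 * M * (s / (4 * (M + 1))) < s := by
        rw [mul_div_assoc', div_lt_iff₀ (by positivity)]; nlinarith
      linarith
    intro δ hδ
    obtain ⟨n₁, hn₁⟩ := hPa R δ hδ
    obtain ⟨n₂, hn₂⟩ := hQa R δ hδ
    set n := max n₁ n₂
    have hPn := hn₁ n (le_max_left _ _)
    have hQn := hn₂ n (le_max_right _ _)
    set D : ℝ := (d : ℝ) ^ n with hD
    have hD0 : 0 < D := by positivity
    set U : Set ℂ := Metric.ball 0 R ∩ {t | c < g₁ t} with hU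
    have hclU : ∀ t ∈ closure U, ‖t‖ ≤ R ∧ c ≤ g₁ t := by
      intro t ht
      have h1 : closure U ⊆ Metric.closedBall 0 R ∩ {t | c ≤ g₁ t} := by
        apply closure_minimal
        · rintro s ⟨hs1, hs2⟩
          exact ⟨Metric.ball_subset_closedBall hs1, show c ≤ g₁ s from le_of_lt hs2⟩
        · exact Metric.isClosed_closedBall.inter (isClosed_le continuous_const hg₁)
      have h2 := h1 ht
      exact ⟨by simpa using h2.1, h2.2⟩
    have hUo : IsOpen U := Metric.isOpen_ball.inter (isOpen_lt continuous_const hg₁)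
    set F : ℂ → ℂ := fun t => P n t ^ (N * k) / Q n t ^ ((N + 1) * l) with hF
    have hlogF : ∀ t ∈ closure U, ‖F t‖ =
        Real.exp (D * (N * k * (Real.log ‖P n t‖ / D) - (N + 1) * l * (Real.log ‖Q n t‖ / D))) := by
      intro t ht
      obtain ⟨h1, h2⟩ := hclU t ht
      have p0 := (hPn t h1 h2).1
      have q0 := (hQn t h1 (hiff t h2)).1
      have : D * (N * k * (Real.log ‖P n t‖ / D) - (N + 1) * l * (Real.log ‖Q n t‖ / D)) =
          Real.log ‖F t‖ := by
        rw [hF]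
        simp only [norm_div, norm_pow]
        rw [Real.log_div (by positivity) (by positivity), Real.log_pow, Real.log_pow]
        push_cast
        field_simp
      rw [this, Real.exp_log]
      simp only [hF, norm_div, norm_pow]
      positivity
    have happ : ∀ t ∈ closure U,
        |(N * k * (Real.log ‖P n t‖ / D) - (N + 1) * l * (Real.log ‖Q n t‖ / D)) -
          (N * k * g₁ t - (N + 1) * l * g₂ t)| ≤ M * δ := by
      intro t ht
      obtain ⟨h1, h2⟩ := hclU t ht
      have p0 := abs_le.1 (hPn t h1 h2).2
      have q0 := abs_le.1 (hQn t h1 (hiff t h2)).2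
      have nk : (0 : ℝ) ≤ N * k := by positivity
      have nl : (0 : ℝ) ≤ (N + 1) * l := by positivity
      rw [abs_le]
      constructor <;> nlinarith [mul_le_mul_of_nonneg_left p0.1 nk,
        mul_le_mul_of_nonneg_left p0.2 nk, mul_le_mul_of_nonneg_left q0.1 nl,
        mul_le_mul_of_nonneg_left q0.2 nl]
    have hdiff : DiffContOnCl ℂ F U := by
      apply DifferentiableOn.diffContOnCl
      intro t ht
      obtain ⟨h1, h2⟩ := hclU t ht
      have q0 := (hQn t h1 (hiff t h2)).1
      exact ((((hP n) t).pow _).div (((hQ n) t).pow _) (pow_ne_zero _ q0)).differentiableWithinAt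
    have hfr : ∀ t ∈ frontier U, ‖F t‖ ≤
        Real.exp (D * (N * k * c - (N + 1) * l * c + M * δ)) := by
      intro t ht
      have htc := frontier_subset_closure ht
      rw [hlogF t htc]
      have ha := (abs_le.1 (happ t htc)).2
      obtain ⟨h1, h2⟩ := hclU t htc
      have hneg : N * (k * (g₁ t - c)) - (N + 1) * (l * (g₂ t - c)) ≤ 0 := by
        by_cases hc1 : c < g₁ t
        · apply hR₀
          by_contra hlt'
          have : t ∈ U := by
            refine ⟨?_, hc1⟩
            rw [mem_ball_zero_iff]
            exact lt_of_lt_of_le (not_le.1 hlt') (le_max_left _ _)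
          rw [hUo.frontier_eq] at ht
          exact ht.2 this
        · have e : g₁ t = c := le_antisymm (not_lt.1 hc1) h2
          have h3 := hiff t h2
          have : 0 ≤ g₂ t - c := by linarith
          rw [e]
          simp only [sub_self, mul_zero, zero_sub, Left.neg_nonpos_iff]
          positivity
      apply Real.exp_le_exp.2
      apply mul_le_mul_of_nonneg_left _ hD0.le
      nlinarith
    have ht₀U : t₀ ∈ closure U := subset_closure ⟨by rwa [mem_ball_zero_iff], hlt⟩
    have hbd : Bornology.IsBounded U := Metric.isBounded_ball.subset inter_subset_left
    have fin := Complex.norm_le_of_forall_mem_frontier_norm_le hbd hdiff hfr ht₀U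
    rw [hlogF t₀ ht₀U, Real.exp_le_exp] at fin
    have fin2 := le_of_mul_le_mul_left fin hD0
    have ha := (abs_le.1 (happ t₀ ht₀U)).1
    nlinarith
  by_contra hcon
  push Not at hcon
  obtain ⟨N, hN⟩ := exists_nat_gt ((l * (g₂ t₀ - c)) / (k * (g₁ t₀ - c) - l * (g₂ t₀ - c)))
  rw [div_lt_iff₀ (by linarith)] at hN
  have := main N
  nlinarith

/-- The escape region. -/
def InV (a : ℂ) (A : ℝ) (z : ℂ × ℂ) : Prop := 4 + 2 * (A + ‖a‖) ≤ ‖z.2‖ ∧ ‖z.1‖ ≤ ‖z.2‖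

lemma G_H (d : ℕ)
    (hd : 2 ≤ d)
    (H : ℂ × ℂ → ℂ × ℂ)
    (G : ℂ × ℂ → ℝ)
    (hGlim : ∀ z : ℂ × ℂ,
      Tendsto (fun n : ℕ => Real.log (max ‖H^[n] z‖ 1) / (d : ℝ) ^ n) atTop (𝓝 (G z)))
    (z : ℂ × ℂ) : G (H z) = d * G z := by
  have hd0 : (d : ℝ) ≠ 0 := by positivity
  have h1 := (hGlim z).comp (tendsto_add_atTop_nat 1)
  have h2 := h1.const_mul (d : ℝ)
  refine tendsto_nhds_unique (hGlim (H z)) (h2.congr fun n => ?_)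
  simp only [Function.comp, Function.iterate_succ, pow_succ]
  field_simp

lemma G_iter (d : ℕ)
    (hd : 2 ≤ d)
    (H : ℂ × ℂ → ℂ × ℂ)
    (G : ℂ × ℂ → ℝ)
    (hGlim : ∀ z : ℂ × ℂ,
      Tendsto (fun n : ℕ => Real.log (max ‖H^[n] z‖ 1) / (d : ℝ) ^ n) atTop (𝓝 (G z)))
    (z : ℂ × ℂ) (n : ℕ) : G (H^[n] z) = (d : ℝ) ^ n * G z := by
  induction n with
  | zero => simp
  | succ n ih => rw [Function.iterate_succ_apply', G_H d hd H G hGlim, ih]; ring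

lemma V_E (a : ℂ)
    (A : ℝ)
    (hA : 0 ≤ A)
    (z : ℂ × ℂ) (hz : InV a A z) : (A + ‖a‖ * ‖z.1‖) / ‖z.2‖ ^ 2 ≤ (A + ‖a‖) / ‖z.2‖ ∧
    (A + ‖a‖) / ‖z.2‖ ≤ 1 / 2 := by
  obtain ⟨h1, h2⟩ := hz
  have ha := norm_nonneg a
  have h0 : 1 ≤ ‖z.2‖ := by linarith
  constructor
  · rw [div_le_div_iff₀ (by positivity) (by positivity)]
    have : ‖a‖ * ‖z.1‖ ≤ ‖a‖ * ‖z.2‖ := by gcongr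
    have h3 : A + ‖a‖ * ‖z.1‖ ≤ (A + ‖a‖) * ‖z.2‖ := by nlinarith
    nlinarith
  · rw [div_le_iff₀ (by positivity)]; linarith

lemma V_step (d : ℕ)
    (hd : 2 ≤ d)
    (a : ℂ)
    (p : Polynomial ℂ)
    (A : ℝ)
    (hA : 0 ≤ A)
    (hp : ∀ y : ℂ, 1 ≤ ‖y‖ → ‖p.eval y - y ^ d‖ ≤ A * ‖y‖ ^ (d - 2))
    (H : ℂ × ℂ → ℂ × ℂ)
    (hH : ∀ z : ℂ × ℂ, H z = (z.2, p.eval z.2 - a * z.1))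
    (z : ℂ × ℂ) (hz : InV a A z) : InV a A (H z) ∧ ‖z.2‖ ≤ ‖(H z).2‖ ∧
    |Real.log ‖(H z).2‖ - d * Real.log ‖z.2‖| ≤ 2 * ((A + ‖a‖) / ‖z.2‖) := by
  obtain ⟨e1, e2⟩ := V_E a A hA z hz
  obtain ⟨h1, h2⟩ := hz
  have ha := norm_nonneg a
  obtain ⟨s1, s2⟩ := step_est d hd a p A hA hp z.1 z.2 (by linarith) (e1.trans e2)
  rw [hH]
  have : ‖z.2‖ ≤ ‖p.eval z.2 - a * z.1‖ := by nlinarith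
  exact ⟨⟨h1.trans this, this⟩, this, s2.trans (by linarith)⟩

lemma V_iter (d : ℕ)
    (hd : 2 ≤ d)
    (a : ℂ)
    (p : Polynomial ℂ)
    (A : ℝ)
    (hA : 0 ≤ A)
    (hp : ∀ y : ℂ, 1 ≤ ‖y‖ → ‖p.eval y - y ^ d‖ ≤ A * ‖y‖ ^ (d - 2))
    (H : ℂ × ℂ → ℂ × ℂ)
    (hH : ∀ z : ℂ × ℂ, H z = (z.2, p.eval z.2 - a * z.1))
    (z : ℂ × ℂ) (hz : InV a A z) (n : ℕ) :
    InV a A (H^[n] z) ∧ ‖z.2‖ ≤ ‖(H^[n] z).2‖ ∧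
    |Real.log ‖(H^[n] z).2‖ / (d : ℝ) ^ n - Real.log ‖z.2‖| ≤
      2 * ((A + ‖a‖) / ‖z.2‖) * (1 - (1 / 2) ^ n) := by
  have ha := norm_nonneg a
  have hz2 : 0 < ‖z.2‖ := by linarith [hz.1]
  induction n with
  | zero => simp [hz]
  | succ n ih =>
    obtain ⟨i1, i2, i3⟩ := ih
    rw [Function.iterate_succ_apply']
    set w := H^[n] z
    obtain ⟨s1, s2, s3⟩ := V_step d hd a p A hA hp H hH w i1
    refine ⟨s1, i2.trans s2, ?_⟩
    have hd0 : (0 : ℝ) < d := by positivity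
    have e : Real.log ‖(H w).2‖ / (d : ℝ) ^ (n + 1) - Real.log ‖z.2‖ =
      (Real.log ‖(H w).2‖ - d * Real.log ‖w.2‖) / (d : ℝ) ^ (n + 1) +
      (Real.log ‖w.2‖ / (d : ℝ) ^ n - Real.log ‖z.2‖) := by
      rw [pow_succ]; field_simp; ring
    rw [e]
    have h4 : |(Real.log ‖(H w).2‖ - d * Real.log ‖w.2‖) / (d : ℝ) ^ (n + 1)| ≤
        2 * ((A + ‖a‖) / ‖z.2‖) * (1 / 2) ^ (n + 1) := by
      rw [abs_div, abs_of_pos (by positivity : (0 : ℝ) < (d : ℝ) ^ (n + 1)), div_eq_mul_inv,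
        one_div, inv_pow]
      have hd2 : (2 : ℝ) ≤ d := by exact_mod_cast hd
      have : (A + ‖a‖) / ‖w.2‖ ≤ (A + ‖a‖) / ‖z.2‖ := by gcongr
      gcongr
      linarith
    calc _ ≤ _ := abs_add_le _ _
      _ ≤ 2 * ((A + ‖a‖) / ‖z.2‖) * (1 / 2) ^ (n + 1) +
          2 * ((A + ‖a‖) / ‖z.2‖) * (1 - (1 / 2) ^ n) := add_le_add h4 i3
      _ = _ := by rw [pow_succ]; ring

lemma V_G (d : ℕ)
    (hd : 2 ≤ d)
    (a : ℂ)
    (p : Polynomial ℂ)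
    (A : ℝ)
    (hA : 0 ≤ A)
    (hp : ∀ y : ℂ, 1 ≤ ‖y‖ → ‖p.eval y - y ^ d‖ ≤ A * ‖y‖ ^ (d - 2))
    (H : ℂ × ℂ → ℂ × ℂ)
    (hH : ∀ z : ℂ × ℂ, H z = (z.2, p.eval z.2 - a * z.1))
    (G : ℂ × ℂ → ℝ)
    (hGlim : ∀ z : ℂ × ℂ,
      Tendsto (fun n : ℕ => Real.log (max ‖H^[n] z‖ 1) / (d : ℝ) ^ n) atTop (𝓝 (G z)))
    (z : ℂ × ℂ) (hz : InV a A z) :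
    |G z - Real.log ‖z.2‖| ≤ 2 * ((A + ‖a‖) / ‖z.2‖) := by
  have ha := norm_nonneg a
  have ht : Tendsto (fun n : ℕ => |Real.log (max ‖H^[n] z‖ 1) / (d : ℝ) ^ n - Real.log ‖z.2‖|)
      atTop (𝓝 |G z - Real.log ‖z.2‖|) := ((hGlim z).sub_const _).abs
  refine le_of_tendsto ht (Eventually.of_forall fun n => ?_)
  obtain ⟨h1, h2, h3⟩ := V_iter d hd a p A hA hp H hH z hz n
  have e : max ‖H^[n] z‖ 1 = ‖(H^[n] z).2‖ := by
    rw [Prod.norm_def, max_eq_right h1.2, max_eq_left]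
    linarith [h1.1]
  rw [e]
  refine h3.trans ?_
  have : 0 ≤ 2 * ((A + ‖a‖) / ‖z.2‖) := by positivity
  have h5 : (0 : ℝ) ≤ (1 / 2) ^ n := by positivity
  nlinarith

/-- Fine asymptotics. -/
lemma G_fine (d : ℕ)
    (hd : 2 ≤ d)
    (a : ℂ)
    (p : Polynomial ℂ)
    (A : ℝ)
    (hA : 0 ≤ A)
    (hp : ∀ y : ℂ, 1 ≤ ‖y‖ → ‖p.eval y - y ^ d‖ ≤ A * ‖y‖ ^ (d - 2))
    (H : ℂ × ℂ → ℂ × ℂ)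
    (hH : ∀ z : ℂ × ℂ, H z = (z.2, p.eval z.2 - a * z.1))
    (G : ℂ × ℂ → ℝ)
    (hGlim : ∀ z : ℂ × ℂ,
      Tendsto (fun n : ℕ => Real.log (max ‖H^[n] z‖ 1) / (d : ℝ) ^ n) atTop (𝓝 (G z)))
    (z : ℂ × ℂ) (h1 : 4 + 2 * (A + ‖a‖) ≤ ‖z.2‖)
    (hE : (A + ‖a‖ * ‖z.1‖) / ‖z.2‖ ^ 2 ≤ 1 / 2) :
    |G z - Real.log ‖z.2‖| ≤ (4 * (A + ‖a‖) + 2 * (A + ‖a‖ * ‖z.1‖)) / ‖z.2‖ ^ 2 := by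
  have ha := norm_nonneg a
  have hz2 : 1 ≤ ‖z.2‖ := by linarith
  have hd1 : (1 : ℝ) ≤ d := by exact_mod_cast (by omega : 1 ≤ d)
  obtain ⟨s1, s2⟩ := step_est d hd a p A hA hp z.1 z.2 hz2 hE
  have h3 : ‖z.2‖ ≤ ‖p.eval z.2 - a * z.1‖ := by nlinarith
  have hV : InV a A (H z) := by rw [hH]; exact ⟨h1.trans h3, h3⟩
  have hG := V_G d hd a p A hA hp H hH G hGlim (H z) hV
  rw [G_H d hd H G hGlim] at hG
  have e : (H z).2 = p.eval z.2 - a * z.1 := by rw [hH]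
  rw [e] at hG
  set Y := p.eval z.2 - a * z.1
  have h4 : (A + ‖a‖) / ‖Y‖ ≤ 2 * (A + ‖a‖) / ‖z.2‖ ^ 2 := by
    have hY : 0 < ‖Y‖ := by linarith
    rw [div_le_div_iff₀ hY (by positivity)]
    nlinarith
  have h5 : |(d : ℝ) * (G z - Real.log ‖z.2‖)| ≤
      (4 * (A + ‖a‖) + 2 * (A + ‖a‖ * ‖z.1‖)) / ‖z.2‖ ^ 2 := by
    have e2 : (d : ℝ) * (G z - Real.log ‖z.2‖) = (d * G z - Real.log ‖Y‖) +
      (Real.log ‖Y‖ - d * Real.log ‖z.2‖) := by ring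
    rw [e2]
    refine (abs_add_le _ _).trans ((add_le_add hG s2).trans ?_)
    have : (4 * (A + ‖a‖) + 2 * (A + ‖a‖ * ‖z.1‖)) / ‖z.2‖ ^ 2 =
      2 * (2 * (A + ‖a‖) / ‖z.2‖ ^ 2) + 2 * ((A + ‖a‖ * ‖z.1‖) / ‖z.2‖ ^ 2) := by ring
    rw [this]
    linarith
  rw [abs_mul, abs_of_pos (by linarith : (0 : ℝ) < d)] at h5
  nlinarith [abs_nonneg (G z - Real.log ‖z.2‖)]

lemma approx (d : ℕ)
    (hd : 2 ≤ d)
    (a : ℂ)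
    (p : Polynomial ℂ)
    (A : ℝ)
    (hA : 0 ≤ A)
    (hp : ∀ y : ℂ, 1 ≤ ‖y‖ → ‖p.eval y - y ^ d‖ ≤ A * ‖y‖ ^ (d - 2))
    (H : ℂ × ℂ → ℂ × ℂ)
    (hH : ∀ z : ℂ × ℂ, H z = (z.2, p.eval z.2 - a * z.1))
    (G : ℂ × ℂ → ℝ)
    (hGcont : Continuous G)
    (hGlim : ∀ z : ℂ × ℂ,
      Tendsto (fun n : ℕ => Real.log (max ‖H^[n] z‖ 1) / (d : ℝ) ^ n) atTop (𝓝 (G z)))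
    (ρ c δ : ℝ) (hc : 0 < c) (hδ : 0 < δ) : ∃ n₀ : ℕ, ∀ n ≥ n₀, ∀ z : ℂ × ℂ,
    ‖z‖ ≤ ρ → c ≤ G z →
    (H^[n] z).2 ≠ 0 ∧ |G z - Real.log ‖(H^[n] z).2‖ / (d : ℝ) ^ n| ≤ δ := by
  have ha := norm_nonneg a
  set R := max ρ (4 + 2 * (A + ‖a‖)) with hR
  obtain ⟨M, hM⟩ := (isCompact_closedBall (0 : ℂ × ℂ) R).bddAbove_image hGcont.continuousOn
  have hd1 : (1 : ℝ) < d := by exact_mod_cast (by omega : 1 < d)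
  have hpow : Tendsto (fun n : ℕ => (d : ℝ) ^ n) atTop atTop := tendsto_pow_atTop_atTop_of_one_lt hd1
  obtain ⟨n₁, hn₁⟩ := (hpow.eventually_gt_atTop (M / c)).exists
  obtain ⟨n₂, hn₂⟩ := eventually_atTop.1 (hpow.eventually_ge_atTop (1 / δ))
  refine ⟨max n₁ n₂, fun n hn z hz hcz => ?_⟩
  -- entered V at some time ≤ n₁
  have hent : ∃ m ≤ n₁, InV a A (H^[m] z) := by
    by_contra hcon
    push Not at hcon
    have hb : ∀ m ≤ n₁, ‖H^[m] z‖ ≤ R := by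
      intro m
      induction m with
      | zero => intro _; exact hz.trans (le_max_left _ _)
      | succ m ih =>
        intro hm
        have h1 := ih (by omega)
        have h2 := hcon (m + 1) hm
        rw [Function.iterate_succ_apply'] at h2 ⊢
        have e : (H (H^[m] z)).1 = (H^[m] z).2 := by rw [hH]
        have h3 : ‖(H (H^[m] z)).1‖ ≤ R := by rw [e]; exact (norm_snd_le _).trans h1
        rw [Prod.norm_def]
        refine max_le h3 ?_
        by_contra h4
        push Not at h4
        exact h2 ⟨(le_max_right _ _).trans h4.le, h3.trans h4.le⟩
    have h1 : G (H^[n₁] z) ≤ M := hM ⟨_, by simpa using hb n₁ le_rfl, rfl⟩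
    rw [G_iter d hd H G hGlim] at h1
    rw [div_lt_iff₀ hc] at hn₁
    have : (0 : ℝ) < (d : ℝ) ^ n₁ := by positivity
    nlinarith
  obtain ⟨m, hm, hmV⟩ := hent
  have hV : InV a A (H^[n] z) := by
    have e : n = (n - m) + m := by have := le_max_left n₁ n₂; omega
    rw [e, Function.iterate_add_apply]
    exact (V_iter d hd a p A hA hp H hH _ hmV _).1
  have hG := V_G d hd a p A hA hp H hH G hGlim _ hV
  have hE := (V_E a A hA _ hV).2
  rw [G_iter d hd H G hGlim] at hG
  have hpos : 0 < ‖(H^[n] z).2‖ := by linarith [hV.1]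
  refine ⟨norm_pos_iff.1 hpos, ?_⟩
  have hD : (0 : ℝ) < (d : ℝ) ^ n := by positivity
  have h6 := hn₂ n (le_trans (le_max_right _ _) hn)
  rw [div_le_iff₀ hδ] at h6
  have e : G z - Real.log ‖(H^[n] z).2‖ / (d : ℝ) ^ n =
    ((d : ℝ) ^ n * G z - Real.log ‖(H^[n] z).2‖) / (d : ℝ) ^ n := by field_simp
  rw [e, abs_div, abs_of_pos hD, div_le_iff₀ hD]
  linarith

/-- Growth along non-horizontal lines. -/
lemma growth_aux (d : ℕ)
    (hd : 2 ≤ d)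
    (a : ℂ)
    (p : Polynomial ℂ)
    (A : ℝ)
    (hA : 0 ≤ A)
    (hp : ∀ y : ℂ, 1 ≤ ‖y‖ → ‖p.eval y - y ^ d‖ ≤ A * ‖y‖ ^ (d - 2))
    (H : ℂ × ℂ → ℂ × ℂ)
    (hH : ∀ z : ℂ × ℂ, H z = (z.2, p.eval z.2 - a * z.1))
    (G : ℂ × ℂ → ℝ)
    (hGlim : ∀ z : ℂ × ℂ,
      Tendsto (fun n : ℕ => Real.log (max ‖H^[n] z‖ 1) / (d : ℝ) ^ n) atTop (𝓝 (G z)))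
    (z v : ℂ × ℂ) (hv : v.2 ≠ 0) :
    Tendsto (fun t : ℂ => G (z + t • v) - Real.log ‖t‖) (Bornology.cobounded ℂ)
      (𝓝 (Real.log ‖v.2‖)) := by
  have hinv : Tendsto (fun t : ℂ => t⁻¹) (Bornology.cobounded ℂ) (𝓝 0) := tendsto_inv₀_cobounded
  have hne : ∀ᶠ t : ℂ in Bornology.cobounded ℂ, t ≠ 0 := Bornology.eventually_ne_cobounded 0
  have hy : Tendsto (fun t : ℂ => z.2 * t⁻¹ + v.2) (Bornology.cobounded ℂ) (𝓝 v.2) := by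
    simpa using (hinv.const_mul z.2).add_const v.2
  have hx : Tendsto (fun t : ℂ => z.1 * t⁻¹ + v.1) (Bornology.cobounded ℂ) (𝓝 v.1) := by
    simpa using (hinv.const_mul z.1).add_const v.1
  have hyn : ∀ᶠ t : ℂ in Bornology.cobounded ℂ, z.2 * t⁻¹ + v.2 ≠ 0 := hy.eventually_ne hv
  have hnorm : Tendsto (fun t : ℂ => ‖t‖) (Bornology.cobounded ℂ) atTop :=
    tendsto_norm_cobounded_atTop
  have hninv : Tendsto (fun t : ℂ => ‖t‖⁻¹) (Bornology.cobounded ℂ) (𝓝 0) :=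
    tendsto_inv_atTop_zero.comp hnorm
  have hycoord : ∀ᶠ t : ℂ in Bornology.cobounded ℂ,
      ‖(z + t • v).2‖ = ‖z.2 * t⁻¹ + v.2‖ * ‖t‖ := by
    filter_upwards [hne] with t ht
    rw [← norm_mul]; congr 1
    simp only [Prod.snd_add, Prod.smul_snd, smul_eq_mul]; field_simp
  have hxcoord : ∀ᶠ t : ℂ in Bornology.cobounded ℂ,
      ‖(z + t • v).1‖ = ‖z.1 * t⁻¹ + v.1‖ * ‖t‖ := by
    filter_upwards [hne] with t ht
    rw [← norm_mul]; congr 1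
    simp only [Prod.fst_add, Prod.smul_fst, smul_eq_mul]; field_simp
  have hybig : Tendsto (fun t : ℂ => ‖(z + t • v).2‖) (Bornology.cobounded ℂ) atTop :=
    (Tendsto.pos_mul_atTop (norm_pos_iff.2 hv) hy.norm hnorm).congr' (hycoord.mono fun t h => h.symm)
  have hEgen : ∀ B C : ℝ, Tendsto (fun t : ℂ => (B + C * ‖(z + t • v).1‖) / ‖(z + t • v).2‖ ^ 2)
      (Bornology.cobounded ℂ) (𝓝 0) := by
    intro B C
    have h1 : Tendsto (fun t : ℂ => (B * ‖t‖⁻¹ + C * ‖z.1 * t⁻¹ + v.1‖) * ‖t‖⁻¹ /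
        ‖z.2 * t⁻¹ + v.2‖ ^ 2) (Bornology.cobounded ℂ)
        (𝓝 ((B * 0 + C * ‖v.1‖) * 0 / ‖v.2‖ ^ 2)) :=
      (((hninv.const_mul B).add (hx.norm.const_mul C)).mul hninv).div (hy.norm.pow 2)
        (by positivity)
    simp only [mul_zero, zero_div] at h1
    refine h1.congr' ?_
    filter_upwards [hne, hyn, hycoord, hxcoord] with t h1 h2 h3 h4
    rw [h3, h4]
    have : 0 < ‖t‖ := norm_pos_iff.2 h1
    have : 0 < ‖z.2 * t⁻¹ + v.2‖ := norm_pos_iff.2 h2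
    field_simp
  have hmain : Tendsto (fun t : ℂ => G (z + t • v) - Real.log ‖(z + t • v).2‖)
      (Bornology.cobounded ℂ) (𝓝 0) := by
    apply squeeze_zero_norm' _ (hEgen (4 * (A + ‖a‖) + 2 * A) (2 * ‖a‖))
    filter_upwards [hybig.eventually_ge_atTop (4 + 2 * (A + ‖a‖)),
      (hEgen A ‖a‖).eventually_le_const (by norm_num : (0 : ℝ) < 1 / 2)] with t h1 h2
    refine (G_fine d hd a p A hA hp H hH G hGlim _ h1 h2).trans (le_of_eq ?_)
    ring
  have hlog : Tendsto (fun t : ℂ => Real.log ‖z.2 * t⁻¹ + v.2‖) (Bornology.cobounded ℂ)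
      (𝓝 (Real.log ‖v.2‖)) := hy.norm.log (by positivity)
  have := hmain.add hlog
  rw [zero_add] at this
  refine this.congr' ?_
  filter_upwards [hne, hyn, hycoord] with t h1 h2 h3
  rw [h3, Real.log_mul (by positivity) (by positivity)]
  ring

lemma growth_hor (d : ℕ)
    (hd : 2 ≤ d)
    (a : ℂ)
    (p : Polynomial ℂ)
    (A : ℝ)
    (hA : 0 ≤ A)
    (hp : ∀ y : ℂ, 1 ≤ ‖y‖ → ‖p.eval y - y ^ d‖ ≤ A * ‖y‖ ^ (d - 2))
    (H : ℂ × ℂ → ℂ × ℂ)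
    (hH : ∀ z : ℂ × ℂ, H z = (z.2, p.eval z.2 - a * z.1))
    (G : ℂ × ℂ → ℝ)
    (hGlim : ∀ z : ℂ × ℂ,
      Tendsto (fun n : ℕ => Real.log (max ‖H^[n] z‖ 1) / (d : ℝ) ^ n) atTop (𝓝 (G z)))
    (ha : a ≠ 0) (z v : ℂ × ℂ) (hv : v.2 = 0) (hv1 : v.1 ≠ 0) :
    Tendsto (fun t : ℂ => d * G (z + t • v) - Real.log ‖t‖) (Bornology.cobounded ℂ)
      (𝓝 (Real.log ‖-a * v.1‖)) := by
  have := growth_aux d hd a p A hA hp H hH G hGlim (H z) (0, -a * v.1) (by simp [ha, hv1])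
  refine this.congr fun t => ?_
  rw [← G_H d hd H G hGlim]
  congr 2
  rw [hH, hH]
  ext
  · simp [hv]
  · simp [hv]; ring

/-- growth exponent inverse -/
def kap (d : ℕ) (v : ℂ × ℂ) : ℕ := by classical exact if v.2 = 0 then d else 1

lemma growth (d : ℕ)
    (hd : 2 ≤ d)
    (a : ℂ)
    (p : Polynomial ℂ)
    (A : ℝ)
    (hA : 0 ≤ A)
    (hp : ∀ y : ℂ, 1 ≤ ‖y‖ → ‖p.eval y - y ^ d‖ ≤ A * ‖y‖ ^ (d - 2))
    (H : ℂ × ℂ → ℂ × ℂ)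
    (hH : ∀ z : ℂ × ℂ, H z = (z.2, p.eval z.2 - a * z.1))
    (G : ℂ × ℂ → ℝ)
    (hGlim : ∀ z : ℂ × ℂ,
      Tendsto (fun n : ℕ => Real.log (max ‖H^[n] z‖ 1) / (d : ℝ) ^ n) atTop (𝓝 (G z)))
    (ha : a ≠ 0) (z v : ℂ × ℂ) (hv : v ≠ 0) :
    ∃ K₀ : ℝ, ∀ K ≥ K₀, ∀ᶠ t in Bornology.cobounded ℂ,
      |kap d v * G (z + t • v) - Real.log ‖t‖| ≤ K := by
  have : ∃ l : ℝ, Tendsto (fun t : ℂ => kap d v * G (z + t • v) - Real.log ‖t‖)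
      (Bornology.cobounded ℂ) (𝓝 l) := by
    by_cases h : v.2 = 0
    · have h1 : v.1 ≠ 0 := fun h1 => hv (Prod.ext h1 h)
      refine ⟨_, (growth_hor d hd a p A hA hp H hH G hGlim ha z v h h1).congr fun t => ?_⟩
      simp [kap, h]
    · refine ⟨_, (growth_aux d hd a p A hA hp H hH G hGlim z v h).congr fun t => ?_⟩
      simp [kap, h]
  obtain ⟨l, hl⟩ := this
  refine ⟨|l| + 1, fun K hK => ?_⟩
  filter_upwards [hl.abs.eventually_le_const (lt_add_one |l|)] with t ht
  exact ht.trans hK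

lemma diff_iter (a : ℂ)
    (p : Polynomial ℂ)
    (H : ℂ × ℂ → ℂ × ℂ)
    (hH : ∀ z : ℂ × ℂ, H z = (z.2, p.eval z.2 - a * z.1))
    (z v : ℂ × ℂ) (n : ℕ) :
    Differentiable ℂ (fun t : ℂ => (H^[n] (z + t • v)).2) := by
  have hHd : Differentiable ℂ H := by
    have : H = fun z : ℂ × ℂ => (z.2, p.eval z.2 - a * z.1) := funext hH
    rw [this]
    have h1 : Differentiable ℂ (fun z : ℂ × ℂ => p.eval z.2) :=
      p.differentiable.comp differentiable_snd
    fun_prop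
  have h2 : Differentiable ℂ (H^[n]) := hHd.iterate n
  have h3 : Differentiable ℂ (fun t : ℂ => z + t • v) := by fun_prop
  exact differentiable_snd.comp (h2.comp h3)

lemma line_compare (d : ℕ)
    (hd : 2 ≤ d)
    (a : ℂ)
    (p : Polynomial ℂ)
    (A : ℝ)
    (hA : 0 ≤ A)
    (hp : ∀ y : ℂ, 1 ≤ ‖y‖ → ‖p.eval y - y ^ d‖ ≤ A * ‖y‖ ^ (d - 2))
    (H : ℂ × ℂ → ℂ × ℂ)
    (hH : ∀ z : ℂ × ℂ, H z = (z.2, p.eval z.2 - a * z.1))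
    (G : ℂ × ℂ → ℝ)
    (hGcont : Continuous G)
    (hGlim : ∀ z : ℂ × ℂ,
      Tendsto (fun n : ℕ => Real.log (max ‖H^[n] z‖ 1) / (d : ℝ) ^ n) atTop (𝓝 (G z)))
    (ha : a ≠ 0) (c : ℝ) (hc : 0 < c) (z v w u : ℂ × ℂ) (hv : v ≠ 0) (hu : u ≠ 0)
    (hiff : ∀ t : ℂ, c ≤ G (z + t • v) → c ≤ G (w + t • u)) (hz : c ≤ G z) :
    kap d v * (G z - c) ≤ kap d u * (G w - c) := by
  obtain ⟨K₁, hK₁⟩ := growth d hd a p A hA hp H hH G hGlim ha z v hv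
  obtain ⟨K₂, hK₂⟩ := growth d hd a p A hA hp H hH G hGlim ha w u hu
  have hap : ∀ z v : ℂ × ℂ, ∀ R δ : ℝ, 0 < δ → ∃ n₀, ∀ n ≥ n₀, ∀ t : ℂ, ‖t‖ ≤ R →
      c ≤ G (z + t • v) → (H^[n] (z + t • v)).2 ≠ 0 ∧
      |G (z + t • v) - Real.log ‖(H^[n] (z + t • v)).2‖ / (d : ℝ) ^ n| ≤ δ := by
    intro z v R δ hδ
    obtain ⟨n₀, hn₀⟩ := approx d hd a p A hA hp H hH G hGcont hGlim (‖z‖ + R * ‖v‖) c δ hc hδ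
    refine ⟨n₀, fun n hn t ht hct => hn₀ n hn _ ?_ hct⟩
    refine (norm_add_le _ _).trans ?_
    rw [norm_smul]
    gcongr
  have := compare d hd c (fun t => G (z + t • v)) (fun t => G (w + t • u))
    (hGcont.comp (by fun_prop)) (fun n t => (H^[n] (z + t • v)).2)
    (fun n t => (H^[n] (w + t • u)).2) (diff_iter a p H hH z v) (diff_iter a p H hH w u)
    (hap z v) (hap w u) hiff (kap d v) (kap d u) (max K₁ K₂)
    (hK₁ _ (le_max_left _ _)) (hK₂ _ (le_max_right _ _)) 0 (by simpa using hz)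
  simpa using this

lemma line_eq (d : ℕ)
    (hd : 2 ≤ d)
    (a : ℂ)
    (p : Polynomial ℂ)
    (A : ℝ)
    (hA : 0 ≤ A)
    (hp : ∀ y : ℂ, 1 ≤ ‖y‖ → ‖p.eval y - y ^ d‖ ≤ A * ‖y‖ ^ (d - 2))
    (H : ℂ × ℂ → ℂ × ℂ)
    (hH : ∀ z : ℂ × ℂ, H z = (z.2, p.eval z.2 - a * z.1))
    (G : ℂ × ℂ → ℝ)
    (hGcont : Continuous G)
    (hGlim : ∀ z : ℂ × ℂ,
      Tendsto (fun n : ℕ => Real.log (max ‖H^[n] z‖ 1) / (d : ℝ) ^ n) atTop (𝓝 (G z)))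
    (ha : a ≠ 0) (c : ℝ) (hc : 0 < c) (z v w u : ℂ × ℂ) (hv : v ≠ 0) (hu : u ≠ 0)
    (hiff : ∀ t : ℂ, c ≤ G (z + t • v) ↔ c ≤ G (w + t • u)) (hz : c ≤ G z) :
    kap d v * (G z - c) = kap d u * (G w - c) := by
  have hw : c ≤ G w := by simpa using (hiff 0).1 (by simpa using hz)
  exact le_antisymm
    (line_compare d hd a p A hA hp H hH G hGcont hGlim ha c hc z v w u hv hu
      (fun t => (hiff t).1) hz)
    (line_compare d hd a p A hA hp H hH G hGcont hGlim ha c hc w u z v hu hv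
      (fun t => (hiff t).2) hw)

/-- Key lemma: a triangular affine map preserving `G` where `G` is large. -/
lemma key_lemma (d : ℕ)
    (hd : 2 ≤ d)
    (a : ℂ)
    (p : Polynomial ℂ)
    (A : ℝ)
    (hA : 0 ≤ A)
    (hp : ∀ y : ℂ, 1 ≤ ‖y‖ → ‖p.eval y - y ^ d‖ ≤ A * ‖y‖ ^ (d - 2))
    (H : ℂ × ℂ → ℂ × ℂ)
    (hH : ∀ z : ℂ × ℂ, H z = (z.2, p.eval z.2 - a * z.1))
    (G : ℂ × ℂ → ℝ)
    (hGlim : ∀ z : ℂ × ℂ,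
      Tendsto (fun n : ℕ => Real.log (max ‖H^[n] z‖ 1) / (d : ℝ) ^ n) atTop (𝓝 (G z)))
    (ha : a ≠ 0) (α β γ b b' : ℂ) (hα : α ≠ 0) (C : ℝ)
    (hinv : ∀ z : ℂ × ℂ, C ≤ G z → G (α * z.1 + β * z.2 + γ, b * z.2 + b') = G z) (y : ℂ) :
    p.eval (b * y + b') = α * p.eval y + a * (β * y + γ) := by
  set κ : ℂ := p.eval (b * y + b') - (α * p.eval y + a * (β * y + γ)) with hκ
  have hd0 : (0 : ℝ) < d := by positivity
  have hg1 := growth_aux d hd a p A hA hp H hH G hGlim (y, 0) (0, 1) (by simp)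
  have hg2 := growth_aux d hd a p A hA hp H hH G hGlim (b * y + b', κ) (0, α) (by simpa using hα)
  -- equality of G along vertical lines
  have heq : ∀ Y : ℂ, d * C ≤ G (y, Y) → G (b * y + b', α * Y + κ) = G (y, Y) := by
    intro Y hY
    have e : H ((p.eval y - Y) / a, y) = (y, Y) := by
      rw [hH]; ext <;> simp; field_simp; ring
    rw [← e, G_H d hd H G hGlim] at hY
    have h1 := hinv _ (le_of_mul_le_mul_left hY hd0)
    rw [← e, G_H d hd H G hGlim, ← h1, ← G_H d hd H G hGlim]
    congr 1
    rw [hH]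
    ext
    · simp
    · simp only [hκ]; field_simp; ring
  have hlog : Tendsto (fun t : ℂ => Real.log ‖t‖) (Bornology.cobounded ℂ) atTop :=
    Real.tendsto_log_atTop.comp tendsto_norm_cobounded_atTop
  have hbig : Tendsto (fun t : ℂ => G (y, t)) (Bornology.cobounded ℂ) atTop := by
    refine (hg1.add_atTop hlog).congr fun t => ?_
    simp
  have hα1 : ‖α‖ = 1 := by
    have : Real.log ‖α‖ = Real.log ‖(1 : ℂ)‖ := by
      refine tendsto_nhds_unique hg2 (hg1.congr' ?_)
      filter_upwards [hbig.eventually_ge_atTop (d * C)] with t ht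
      have := heq t ht
      simp only [Prod.mk_add_mk, Prod.smul_mk, smul_eq_mul, mul_zero, add_zero, zero_add, mul_one]
      rw [← this, add_comm κ, mul_comm t α]
    exact Real.log_injOn_pos (norm_pos_iff.2 hα) (by simp) (by simpa using this)
  by_contra hne
  have hκ0 : κ ≠ 0 := fun h => hne (sub_eq_zero.1 h)
  have hκn : 0 < ‖κ‖ := norm_pos_iff.2 hκ0
  -- the test sequence
  set Y : ℝ → ℂ := fun s => (s : ℂ) * (κ / α) with hYdef
  have hYn : ∀ s : ℝ, 0 < s → ‖Y s‖ = s * ‖κ‖ := by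
    intro s hs
    simp [hYdef, hα1, abs_of_pos hs]
  have hYn' : ∀ s : ℝ, 0 < s → ‖α * Y s + κ‖ = (s + 1) * ‖κ‖ := by
    intro s hs
    have : α * Y s + κ = ((s + 1 : ℝ) : ℂ) * κ := by
      simp only [hYdef]; push_cast; field_simp
    rw [this, norm_mul, Complex.norm_real, Real.norm_of_nonneg (by linarith)]
  have hYbig : Tendsto (fun s => ‖Y s‖) atTop atTop := by
    refine (tendsto_id.atTop_mul_const hκn).congr' ?_
    filter_upwards [eventually_gt_atTop 0] with s hs
    rw [hYn s hs]; rfl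
  have hYcob : Tendsto Y atTop (Bornology.cobounded ℂ) := tendsto_norm_atTop_iff_cobounded.1 hYbig
  have han := norm_nonneg a
  set B₁ := 4 * (A + ‖a‖) + 2 * (A + ‖a‖ * ‖y‖) with hB₁
  set B₂ := 4 * (A + ‖a‖) + 2 * (A + ‖a‖ * ‖b * y + b'‖) with hB₂
  have hB₁0 : 0 ≤ B₁ := by positivity
  have hB₂0 : 0 ≤ B₂ := by positivity
  have hsq : Tendsto (fun s => ‖Y s‖ ^ 2) atTop atTop :=
    (tendsto_pow_atTop (by norm_num)).comp hYbig
  have hfin : ∀ᶠ s : ℝ in atTop, s ^ 2 / (s + 1) ≤ (B₁ + B₂) / ‖κ‖ ^ 2 := by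
    filter_upwards [eventually_ge_atTop 1, hYbig.eventually_ge_atTop (4 + 2 * (A + ‖a‖)),
      hsq.eventually_ge_atTop B₁, hsq.eventually_ge_atTop B₂,
      hYcob.eventually (hbig.eventually_ge_atTop (d * C))] with s hs h1 h2 h3 h4
    have hs0 : 0 < s := by linarith
    have hle : ‖Y s‖ ≤ ‖α * Y s + κ‖ := by rw [hYn s hs0, hYn' s hs0]; nlinarith
    have hY0 : 0 < ‖Y s‖ := by linarith
    have hY0' : 0 < ‖α * Y s + κ‖ := by linarith
    have f1 := G_fine d hd a p A hA hp H hH G hGlim (y, Y s) h1 (by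
      rw [div_le_iff₀ (by positivity)]; simp only; linarith)
    have f2 := G_fine d hd a p A hA hp H hH G hGlim (b * y + b', α * Y s + κ) (h1.trans hle) (by
      have : ‖Y s‖ ^ 2 ≤ ‖α * Y s + κ‖ ^ 2 := by gcongr
      rw [div_le_iff₀ (by positivity)]; simp only; linarith)
    rw [heq _ h4] at f2
    simp only at f1 f2
    have f3 : B₂ / ‖α * Y s + κ‖ ^ 2 ≤ B₂ / ‖Y s‖ ^ 2 := by gcongr
    have f4 : Real.log ‖α * Y s + κ‖ - Real.log ‖Y s‖ ≤ (B₁ + B₂) / ‖Y s‖ ^ 2 := by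
      rw [add_div]
      linarith [(abs_le.1 f1).2, (abs_le.1 f2).1]
    have f5 : 1 / (s + 1) ≤ Real.log ‖α * Y s + κ‖ - Real.log ‖Y s‖ := by
      rw [← Real.log_div hY0'.ne' hY0.ne', hYn s hs0, hYn' s hs0, mul_div_mul_right _ _ hκn.ne']
      refine le_trans (le_of_eq ?_) (Real.one_sub_inv_le_log_of_pos (by positivity))
      field_simp; ring
    have f6 := f5.trans f4
    rw [hYn s hs0, mul_pow] at f6
    calc s ^ 2 / (s + 1) = s ^ 2 * (1 / (s + 1)) := by ring
      _ ≤ s ^ 2 * ((B₁ + B₂) / (s ^ 2 * ‖κ‖ ^ 2)) := by gcongr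
      _ = _ := by field_simp
  set B := (B₁ + B₂) / ‖κ‖ ^ 2
  obtain ⟨s, hs1, hs2, hs3⟩ := (hfin.and ((eventually_ge_atTop 1).and
    (eventually_gt_atTop (2 * B)))).exists
  rw [div_le_iff₀ (by linarith)] at hs1
  nlinarith

lemma lead_coeff (d : ℕ) (p : Polynomial ℂ) (hpm : p.Monic) (hpd : p.natDegree = d) (r s : ℂ)
    (h : ∀ y, p.eval (r * y) = s * p.eval y) : r ^ d = s := by
  have e : p.comp (Polynomial.C r * Polynomial.X) = Polynomial.C s * p := by
    apply Polynomial.funext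
    intro y
    simp [h y]
  have h1 := congrArg (fun q => Polynomial.coeff q d) e
  have h2 : p.coeff d = 1 := by rw [← hpd]; exact hpm
  simpa [Polynomial.comp_C_mul_X_coeff, h2] using h1

lemma exists_fixed (d : ℕ) (hd : 2 ≤ d) (a : ℂ) (p : Polynomial ℂ) (hpd : p.natDegree = d) :
    ∃ x : ℂ, p.eval x - a * x = x := by
  have hdeg : (p - Polynomial.C (a + 1) * Polynomial.X).degree ≠ 0 := by
    have h1 : (p - Polynomial.C (a + 1) * Polynomial.X).natDegree = d := by
      rw [Polynomial.natDegree_sub_eq_left_of_natDegree_lt, hpd]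
      exact lt_of_le_of_lt (Polynomial.natDegree_C_mul_le _ _) (by rw [Polynomial.natDegree_X]; omega)
    intro h0
    have h2 := Polynomial.natDegree_eq_zero_iff_degree_le_zero.2 h0.le
    omega
  obtain ⟨x, hx⟩ := IsAlgClosed.exists_root _ hdeg
  refine ⟨x, ?_⟩
  simp [Polynomial.IsRoot] at hx
  linear_combination hx

lemma part_one (d : ℕ) (hd : 2 ≤ d) (a : ℂ) (ha : a ≠ 0)
    (p : Polynomial ℂ) (hpm : p.Monic) (hpd : p.natDegree = d)
    (hpc : p.coeff (d - 1) = 0)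
    (H : ℂ × ℂ → ℂ × ℂ) (hH : ∀ z : ℂ × ℂ, H z = (z.2, p.eval z.2 - a * z.1))
    (G : ℂ × ℂ → ℝ) (hGcont : Continuous G)
    (hGlim : ∀ z : ℂ × ℂ,
      Tendsto (fun n : ℕ => Real.log (max ‖H^[n] z‖ 1) / (d : ℝ) ^ n) atTop (𝓝 (G z)))
    (c : ℝ) (hc : 0 < c) (L : ℂ × ℂ → ℂ × ℂ) (hL : IsAffine L)
    (hΩ : L '' {z : ℂ × ℂ | G z < c} = {z : ℂ × ℂ | G z < c}) :
    ∃ e : ℂ, e ^ (d ^ 2 - 1) = 1 ∧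
        (∀ z : ℂ × ℂ, L z = (e * z.1, e ^ d * z.2)) ∧
        (∀ w : ℂ, p.eval (e ^ d * w) = e * p.eval w) := by
  obtain ⟨A, hA, hp⟩ := poly_bound d hd p hpm hpd hpc
  obtain ⟨a₁, a₂, a₃, b₁, b₂, b₃, hL⟩ := hL
  have hd1 : (1 : ℝ) < d := by exact_mod_cast (by omega : 1 < d)
  -- a point of Ω
  obtain ⟨x₀, hx₀⟩ := exists_fixed d hd a p hpd
  have hfix : H (x₀, x₀) = (x₀, x₀) := by rw [hH]; simp [hx₀]
  have hG0 : G (x₀, x₀) = 0 := by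
    have := G_H d hd H G hGlim (x₀, x₀)
    rw [hfix] at this
    nlinarith
  have hopen : IsOpen {z : ℂ × ℂ | G z < c} := isOpen_lt hGcont continuous_const
  -- determinant
  have hdet : a₁ * b₂ - a₂ * b₁ ≠ 0 := by
    intro hdet
    obtain ⟨ε, hε, hball⟩ := Metric.isOpen_iff.1 hopen (x₀, x₀) (by simpa [hG0] using hc)
    set s : ℂ := ((ε / 2 : ℝ) : ℂ) with hs
    have hsn : ‖s‖ = ε / 2 := by
      rw [hs, Complex.norm_real, Real.norm_of_nonneg (by linarith)]
    have hs0 : s ≠ 0 := by rw [← norm_pos_iff, hsn]; linarith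
    have m0 : (x₀, x₀) ∈ L '' {z : ℂ × ℂ | G z < c} := by
      rw [hΩ]; exact hball (Metric.mem_ball_self hε)
    have m1 : (x₀ + s, x₀) ∈ L '' {z : ℂ × ℂ | G z < c} := by
      rw [hΩ]; apply hball; simp [Prod.dist_eq, hsn, hε]
    have m2 : (x₀, x₀ + s) ∈ L '' {z : ℂ × ℂ | G z < c} := by
      rw [hΩ]; apply hball; simp [Prod.dist_eq, hsn, hε]
    obtain ⟨w0, -, h0⟩ := m0
    obtain ⟨w1, -, h1⟩ := m1
    obtain ⟨w2, -, h2⟩ := m2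
    rw [hL, Prod.mk.injEq] at h0 h1 h2
    have z1 : b₁ = 0 := by
      apply (mul_eq_zero.1 (?_ : s * b₁ = 0)).resolve_left hs0
      linear_combination -b₁ * h1.1 + a₁ * h1.2 + b₁ * h0.1 - a₁ * h0.2 - (w1.2 - w0.2) * hdet
    have z2 : b₂ = 0 := by
      apply (mul_eq_zero.1 (?_ : s * b₂ = 0)).resolve_left hs0
      linear_combination -b₂ * h1.1 + a₂ * h1.2 + b₂ * h0.1 - a₂ * h0.2 + (w1.1 - w0.1) * hdet
    rw [z1, z2] at h0 h2
    apply hs0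
    linear_combination h0.2 - h2.2
  have hinj : Function.Injective L := by
    intro z w h
    rw [hL, hL, Prod.mk.injEq] at h
    ext
    · apply mul_left_cancel₀ hdet
      linear_combination b₂ * h.1 - a₂ * h.2
    · apply mul_left_cancel₀ hdet
      linear_combination a₁ * h.2 - b₁ * h.1
  have hiff : ∀ z, c ≤ G z ↔ c ≤ G (L z) := by
    intro z
    rw [← not_lt, ← not_lt, not_iff_not]
    constructor
    · intro h
      have : L z ∈ L '' {z : ℂ × ℂ | G z < c} := ⟨z, h, rfl⟩
      rwa [hΩ] at this
    · intro h
      have : L z ∈ L '' {z : ℂ × ℂ | G z < c} := by rw [hΩ]; exact h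
      obtain ⟨w, hw, hwz⟩ := this
      rwa [← hinj hwz]
  -- comparison along lines
  have hline : ∀ z v : ℂ × ℂ, v ≠ 0 → c ≤ G z →
      kap d v * (G z - c) = kap d (a₁ * v.1 + a₂ * v.2, b₁ * v.1 + b₂ * v.2) * (G (L z) - c) := by
    intro z v hv hz
    apply line_eq d hd a p A hA hp H hH G hGcont hGlim ha c hc z v _ _ hv _ _ hz
    · intro h
      rw [Prod.mk_eq_zero] at h
      apply hv
      ext
      · apply (mul_eq_zero.1 (?_ : _ * v.1 = 0)).resolve_left hdet
        linear_combination b₂ * h.1 - a₂ * h.2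
      · apply (mul_eq_zero.1 (?_ : _ * v.2 = 0)).resolve_left hdet
        linear_combination a₁ * h.2 - b₁ * h.1
    · intro t
      rw [hiff]
      have : L (z + t • v) = L z + t • (a₁ * v.1 + a₂ * v.2, b₁ * v.1 + b₂ * v.2) := by
        rw [hL, hL]
        ext <;> simp <;> ring
      rw [this]
  have hGL : ∀ z, c ≤ G z → G (L z) = G z := by
    intro z hz
    have hv : ∃ s : ℂ, b₁ * s + b₂ ≠ 0 := by
      by_contra hcon
      push Not at hcon
      have h0 := hcon 0
      have h1 := hcon 1
      have e2 : b₂ = 0 := by simpa using h0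
      have e1 : b₁ = 0 := by simpa [e2] using h1
      exact hdet (by rw [e1, e2]; ring)
    obtain ⟨s, hs⟩ := hv
    have := hline z (s, 1) (by simp) hz
    simp [kap, hs] at this
    linarith
  have hb₁ : b₁ = 0 := by
    by_contra hb
    have hlog : Tendsto (fun t : ℂ => Real.log ‖t‖) (Bornology.cobounded ℂ) atTop :=
      Real.tendsto_log_atTop.comp tendsto_norm_cobounded_atTop
    have hg := (growth_aux d hd a p A hA hp H hH G hGlim 0 (0, 1) (by simp)).add_atTop hlog
    obtain ⟨t, ht⟩ := (hg.eventually_gt_atTop c).exists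
    rw [sub_add_cancel] at ht
    have := hline _ (1, 0) (by simp) ht.le
    rw [hGL _ ht.le] at this
    simp [kap, hb] at this
    simp at ht
    nlinarith
  subst hb₁
  have ha₁ : a₁ ≠ 0 := by rintro rfl; apply hdet; ring
  have hb₂ : b₂ ≠ 0 := by rintro rfl; apply hdet; ring
  -- transport of invariance by `H`
  have htrans : ∀ (M M' : ℂ × ℂ → ℂ × ℂ) (C : ℝ), (∀ z, C ≤ G z → G (M z) = G z) →
      (∀ z, H (M z) = M' (H z)) → ∀ z, d * C ≤ G z → G (M' z) = G z := by
    intro M M' C hM hMM z hz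
    have e : H ((p.eval z.1 - z.2) / a, z.1) = z := by
      rw [hH]; ext <;> simp; field_simp; ring
    rw [← e, G_H d hd H G hGlim] at hz
    have h1 := hM _ (le_of_mul_le_mul_left hz (by linarith))
    rw [← e, ← hMM, G_H d hd H G hGlim, G_H d hd H G hGlim, h1]
  have hLtri : ∀ z : ℂ × ℂ, c ≤ G z → G (a₁ * z.1 + a₂ * z.2 + a₃, b₂ * z.2 + b₃) = G z := by
    intro z hz
    rw [← hGL z hz, hL]; simp
  have k1 := key_lemma d hd a p A hA hp H hH G hGlim ha a₁ a₂ a₃ b₂ b₃ ha₁ c hLtri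
  have t1 := htrans (fun z => (a₁ * z.1 + a₂ * z.2 + a₃, b₂ * z.2 + b₃))
    (fun z => (b₂ * z.1 + 0 * z.2 + b₃, a₁ * z.2 + 0)) c hLtri (by
      intro z
      rw [hH, hH]; ext
      · simp
      · simp only [k1]; ring)
  have k2 := key_lemma d hd a p A hA hp H hH G hGlim ha b₂ 0 b₃ a₁ 0 hb₂ _ t1
  have t2 := htrans _ (fun z => (a₁ * z.1 + 0 * z.2 + 0, b₂ * z.2 + 0)) _ t1 (by
      intro z
      rw [hH, hH]; ext
      · simp
      · simp only [k2]; ring)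
  have k3 := key_lemma d hd a p A hA hp H hH G hGlim ha a₁ 0 0 b₂ 0 ha₁ _ t2
  have t3 := htrans _ (fun z => (b₂ * z.1 + 0 * z.2 + 0, a₁ * z.2 + 0)) _ t2 (by
      intro z
      rw [hH, hH]; ext
      · simp
      · simp only [k3]; ring)
  have k4 := key_lemma d hd a p A hA hp H hH G hGlim ha b₂ 0 0 a₁ 0 hb₂ _ t3
  have hb₃ : b₃ = 0 := by
    apply (mul_eq_zero.1 (?_ : a * b₃ = 0)).resolve_left ha
    linear_combination k4 0 - k2 0
  subst hb₃
  have hlin : ∀ y, a₂ * y + a₃ = 0 := by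
    intro y
    apply (mul_eq_zero.1 (?_ : a * (a₂ * y + a₃) = 0)).resolve_left ha
    linear_combination k3 y - k1 y
  have ha₃ : a₃ = 0 := by simpa using hlin 0
  have ha₂ : a₂ = 0 := by simpa [ha₃] using hlin 1
  have l3 : ∀ y, p.eval (b₂ * y) = a₁ * p.eval y := fun y => by simpa using k3 y
  have l4 : ∀ y, p.eval (a₁ * y) = b₂ * p.eval y := fun y => by simpa using k4 y
  have d3 := lead_coeff d p hpm hpd _ _ l3
  have d4 := lead_coeff d p hpm hpd _ _ l4
  refine ⟨a₁, ?_, ?_, ?_⟩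
  · apply mul_left_cancel₀ ha₁
    rw [← pow_succ', mul_one, Nat.sub_add_cancel (Nat.one_le_pow _ _ (by omega)), pow_two, pow_mul,
      d4, d3]
  · intro z
    rw [hL, d4, ha₂, ha₃]; simp
  · intro w
    rw [d4]; exact l3 w

/-- Let `c > 0` and let `L` be an affine map of `ℂ²` with `L(Ω_c) = Ω_c`.
Then there exists `e ∈ ℂ` with `e^(d²-1) = 1` such that `L(x,y) = (e·x, e^d·y)`,
and moreover `p(e^d·z) = e·p(z)` for all `z ∈ ℂ`. In particular, the affine maps of
`ℂ²` preserving `Ω_c` form a finite cyclic group under composition: they embed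
multiplicatively and injectively into the `(d²-1)`-th roots of unity. -/
theorem stmt_7 (d : ℕ) (hd : 2 ≤ d) (a : ℂ) (ha : a ≠ 0)
    (p : Polynomial ℂ) (hpm : p.Monic) (hpd : p.natDegree = d)
    (hpc : p.coeff (d - 1) = 0)
    (H : ℂ × ℂ → ℂ × ℂ) (hH : ∀ z : ℂ × ℂ, H z = (z.2, p.eval z.2 - a * z.1))
    (G : ℂ × ℂ → ℝ) (hGcont : Continuous G) (hGnonneg : ∀ z, 0 ≤ G z)
    (hGlim : ∀ z : ℂ × ℂ,
      Tendsto (fun n : ℕ => Real.log (max ‖H^[n] z‖ 1) / (d : ℝ) ^ n) atTop (𝓝 (G z)))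
    (c : ℝ) (hc : 0 < c) :
    (∀ L : ℂ × ℂ → ℂ × ℂ, IsAffine L →
      L '' {z : ℂ × ℂ | G z < c} = {z : ℂ × ℂ | G z < c} →
      ∃ e : ℂ, e ^ (d ^ 2 - 1) = 1 ∧
        (∀ z : ℂ × ℂ, L z = (e * z.1, e ^ d * z.2)) ∧
        (∀ w : ℂ, p.eval (e ^ d * w) = e * p.eval w)) ∧
    (∃ ι : (ℂ × ℂ → ℂ × ℂ) → ℂ,
      (∀ L, IsAffine L → L '' {z : ℂ × ℂ | G z < c} = {z : ℂ × ℂ | G z < c} →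
        (ι L) ^ (d ^ 2 - 1) = 1) ∧
      (∀ L L', IsAffine L → L '' {z : ℂ × ℂ | G z < c} = {z : ℂ × ℂ | G z < c} →
        IsAffine L' → L' '' {z : ℂ × ℂ | G z < c} = {z : ℂ × ℂ | G z < c} →
        ι (L ∘ L') = ι L * ι L') ∧
      (∀ L L', IsAffine L → L '' {z : ℂ × ℂ | G z < c} = {z : ℂ × ℂ | G z < c} →
        IsAffine L' → L' '' {z : ℂ × ℂ | G z < c} = {z : ℂ × ℂ | G z < c} →
        ι L = ι L' → L = L')) := by
  have key := part_one d hd a ha p hpm hpd hpc H hH G hGcont hGlim c hc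
  refine ⟨key, fun L => (L (1, 0)).1, ?_, ?_, ?_⟩
  · intro L hL hΩ
    obtain ⟨e, h1, h2, -⟩ := key L hL hΩ
    simpa [h2] using h1
  · intro L L' hL hΩ hL' hΩ'
    obtain ⟨e, -, h2, -⟩ := key L hL hΩ
    obtain ⟨e', -, h2', -⟩ := key L' hL' hΩ'
    simp [h2, h2']
  · intro L L' hL hΩ hL' hΩ' hh
    obtain ⟨e, -, h2, -⟩ := key L hL hΩ
    obtain ⟨e', -, h2', -⟩ := key L' hL' hΩ'
    have : e = e' := by simpa [h2, h2'] using hh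
    funext z
    rw [h2, h2', this]
end
end

section
/- For every c > 0 and every base point z₀ ∈ Ω'_c, the fundamental group π₁(Ω'_c, z₀) of the punctured Short ℂ², Ω'_c = {0 < G⁺_H < c} (with its subspace topology from ℂ²), is isomorphic as a group to the additive group ℤ[1/d] = {m/dⁿ : m ∈ ℤ, n ∈ ℕ}, the additive subgroup of ℚ of rationals whose denominator is a power of d. -/
open Filter Topology Set

noncomputable section

open unitInterval

namespace HenonPi1

lemma exp_const {A : Type*} [TopologicalSpace A] [PreconnectedSpace A] (f : A → ℂ)
    (hf : Continuous f) (w : ℂ) (h : ∀ a, Complex.exp (f a) = w) (a b : A) : f a = f b :=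
  Complex.isCoveringMap_exp.const_of_comp hf (fun a a' => Subtype.ext (by simp [h])) a b

lemma exists_log_square (f : C(I × I, ℂ)) (hf : ∀ z, f z ≠ 0) :
    ∃ L : C(I × I, ℂ), ∀ z, Complex.exp (L z) = f z := by
  let pr : ℝ → I := Set.projIcc 0 1 zero_le_one
  have hpr : Continuous pr := continuous_projIcc
  let g : C(ℝ × ℝ, ℂ) := ⟨fun z => f (pr z.1, pr z.2), by fun_prop⟩
  have hg : ∀ z, g z ≠ 0 := fun z => hf _
  have he : Complex.exp (Complex.log (g (0, 0))) = g (0, 0) := Complex.exp_log (hg _)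
  have : ContractibleSpace (ℝ × ℝ) := RealTopologicalVectorSpace.contractibleSpace
  obtain ⟨F, ⟨-, hF⟩, -⟩ :=
    Complex.isCoveringMapOn_exp.existsUnique_continuousMap_lifts g he (fun z => by simpa using hg z)
  refine ⟨⟨fun z => F (z.1, z.2), by fun_prop⟩, fun z => ?_⟩
  have := congrFun hF ((z.1 : ℝ), (z.2 : ℝ))
  simpa [g, pr] using this

lemma exists_log_path (f : C(I, ℂ)) (hf : ∀ z, f z ≠ 0) :
    ∃ L : C(I, ℂ), ∀ z, Complex.exp (L z) = f z := by
  obtain ⟨L, hL⟩ := exists_log_square ⟨fun z => f z.1, by fun_prop⟩ (fun z => hf _)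
  exact ⟨⟨fun t => L (t, 0), by fun_prop⟩, fun t => hL (t, 0)⟩

variable {X : Type*} [TopologicalSpace X]

/-- The loop `γ` has index `q`, as seen at level `n`. -/
def IsIdx (d : ℕ) (y : ℕ → X → ℂ) (V : ℕ → Set X) {x₀ : X} (γ : Path x₀ x₀) (n : ℕ) (q : ℚ) :
    Prop :=
  (∀ t, γ t ∈ V n) ∧ ∃ l : C(I, ℂ), (∀ t, Complex.exp (l t) = y n (γ t)) ∧
    l 1 - l 0 = 2 * Real.pi * Complex.I * ((d : ℂ) ^ n * (q : ℂ))

section abs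

variable {d : ℕ} {y : ℕ → X → ℂ} {V : ℕ → Set X} {x₀ : X}

lemma exists_level
    (hVo : ∀ n, IsOpen (V n))
    (hVm : ∀ n, V n ⊆ V (n + 1))
    (hVc : ∀ x, ∃ n, x ∈ V n)
    {K : Type*} [TopologicalSpace K] [CompactSpace K] (f : K → X)
    (hf : Continuous f) : ∃ N, ∀ n ≥ N, ∀ k, f k ∈ V n := by
  have hmono : Monotone V := monotone_nat_of_le_succ hVm
  obtain ⟨N, hN⟩ := isCompact_univ.elim_directed_cover (fun n => f ⁻¹' V n)
    (fun n => (hVo n).preimage hf) (fun k _ => by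
      obtain ⟨n, hn⟩ := hVc (f k)
      exact mem_iUnion.2 ⟨n, hn⟩)
    (Monotone.directed_le fun i j hij => preimage_mono (hmono hij))
  exact ⟨N, fun n hn k => hmono hn (hN (mem_univ k))⟩

lemma IsIdx.succ
    (hy : ∀ n, Continuous (y n))
    (hVm : ∀ n, V n ⊆ V (n + 1))
    (hy0 : ∀ n, ∀ x ∈ V n, y n x ≠ 0)
    (hyd : ∀ n, ∀ x ∈ V n, y (n + 1) x / (y n x) ^ d ∈ Complex.slitPlane)
    {γ : Path x₀ x₀} {n : ℕ} {q : ℚ} (h : IsIdx d y V γ n q) :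
    IsIdx d y V γ (n + 1) q := by
  obtain ⟨hγ, l, hl, hd⟩ := h
  have hyc := hy n
  have hyc' := hy (n + 1)
  refine ⟨fun t => hVm n (hγ t),
    ⟨fun t => d * l t + Complex.log (y (n + 1) (γ t) / (y n (γ t)) ^ d), ?_⟩, ?_, ?_⟩
  · refine (continuous_const.mul l.continuous).add (Continuous.clog ?_ fun t => hyd n _ (hγ t))
    refine Continuous.div (by fun_prop) (by fun_prop) fun t => pow_ne_zero _ (hy0 n _ (hγ t))
  · intro t
    have h0 := hy0 n _ (hγ t)
    have h1 := Complex.slitPlane_ne_zero (hyd n _ (hγ t))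
    simp only [ContinuousMap.coe_mk]
    rw [Complex.exp_add, Complex.exp_log h1, Complex.exp_nat_mul, hl]
    field_simp
  · simp only [ContinuousMap.coe_mk, Path.source, Path.target]
    have : l 1 = l 0 + 2 * Real.pi * Complex.I * ((d : ℂ) ^ n * (q : ℂ)) := by rw [← hd]; ring
    rw [this]; ring

lemma IsIdx.mono
    (hy : ∀ n, Continuous (y n))
    (hVm : ∀ n, V n ⊆ V (n + 1))
    (hy0 : ∀ n, ∀ x ∈ V n, y n x ≠ 0)
    (hyd : ∀ n, ∀ x ∈ V n, y (n + 1) x / (y n x) ^ d ∈ Complex.slitPlane)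
    {γ : Path x₀ x₀} {n m : ℕ} {q : ℚ} (h : IsIdx d y V γ n q) (hnm : n ≤ m) :
    IsIdx d y V γ m q := by
  induction m, hnm using Nat.le_induction with
  | base => exact h
  | succ m _ ih => exact ih.succ hy hVm hy0 hyd

lemma IsIdx.unique
    (hd : 2 ≤ d)
    (hy : ∀ n, Continuous (y n))
    (hVm : ∀ n, V n ⊆ V (n + 1))
    (hy0 : ∀ n, ∀ x ∈ V n, y n x ≠ 0)
    (hyd : ∀ n, ∀ x ∈ V n, y (n + 1) x / (y n x) ^ d ∈ Complex.slitPlane)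
    {γ : Path x₀ x₀} {n m : ℕ} {q q' : ℚ} (h : IsIdx d y V γ n q)
    (h' : IsIdx d y V γ m q') : q = q' := by
  obtain ⟨-, l, hl, e⟩ := h.mono hy hVm hy0 hyd (le_max_left n m)
  obtain ⟨-, l', hl', e'⟩ := h'.mono hy hVm hy0 hyd (le_max_right n m)
  have hc := exp_const (fun t => l t - l' t) (by fun_prop) 1
    (fun t => by rw [Complex.exp_sub, hl, hl', ← hl, div_self (Complex.exp_ne_zero _)]) 1 0
  have hEq : l 1 - l 0 = l' 1 - l' 0 := by linear_combination hc
  rw [e, e'] at hEq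
  have hd0 : (d : ℂ) ≠ 0 := by exact_mod_cast (by omega : d ≠ 0)
  have := mul_left_cancel₀ (pow_ne_zero _ hd0) (mul_left_cancel₀ Complex.two_pi_I_ne_zero hEq)
  exact_mod_cast this

lemma IsIdx.exists
    (hd : 2 ≤ d)
    (hy : ∀ n, Continuous (y n))
    (hVo : ∀ n, IsOpen (V n))
    (hVm : ∀ n, V n ⊆ V (n + 1))
    (hVc : ∀ x, ∃ n, x ∈ V n)
    (hy0 : ∀ n, ∀ x ∈ V n, y n x ≠ 0)
    (hyd : ∀ n, ∀ x ∈ V n, y (n + 1) x / (y n x) ^ d ∈ Complex.slitPlane)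
    {S : AddSubgroup ℚ}
    (hS : ∀ q : ℚ, q ∈ S ↔ ∃ (m : ℤ) (n : ℕ), q = (m : ℚ) / (d : ℚ) ^ n) (γ : Path x₀ x₀) :
    ∃ q : S, ∃ n, IsIdx d y V γ n q := by
  obtain ⟨n, hn⟩ := exists_level hVo hVm hVc γ γ.continuous
  have hyc := hy n
  obtain ⟨l, hl⟩ := exists_log_path ⟨fun t => y n (γ t), by fun_prop⟩
    (fun t => hy0 n _ (hn n le_rfl t))
  have hd0 : (d : ℂ) ≠ 0 := by exact_mod_cast (by omega : d ≠ 0)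
  have : Complex.exp (l 1) = Complex.exp (l 0) := by rw [hl, hl]; simp
  obtain ⟨m, hm⟩ := Complex.exp_eq_exp_iff_exists_int.1 this
  refine ⟨⟨(m : ℚ) / (d : ℚ) ^ n, (hS _).2 ⟨m, n, rfl⟩⟩, n, hn n le_rfl, l, hl, ?_⟩
  rw [hm]; push_cast; field_simp; ring

lemma IsIdx.homotopic
    (hd : 2 ≤ d)
    (hy : ∀ n, Continuous (y n))
    (hVo : ∀ n, IsOpen (V n))
    (hVm : ∀ n, V n ⊆ V (n + 1))
    (hVc : ∀ x, ∃ n, x ∈ V n)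
    (hy0 : ∀ n, ∀ x ∈ V n, y n x ≠ 0)
    (hyd : ∀ n, ∀ x ∈ V n, y (n + 1) x / (y n x) ^ d ∈ Complex.slitPlane)
    {γ γ' : Path x₀ x₀} {n n' : ℕ} {q q' : ℚ} (h : IsIdx d y V γ n q)
    (h' : IsIdx d y V γ' n' q') (hh : γ.Homotopic γ') : q = q' := by
  obtain ⟨F⟩ := hh
  obtain ⟨N, hN⟩ := exists_level hVo hVm hVc F F.continuous
  have hyc := hy N
  obtain ⟨L, hL⟩ := exists_log_square ⟨fun t => y N (F t), by fun_prop⟩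
    (fun t => hy0 N _ (hN N le_rfl t))
  have hd0 : (d : ℂ) ≠ 0 := by exact_mod_cast (by omega : d ≠ 0)
  have e0 : L (0, 0) = L (1, 0) := exp_const (fun s : I => L (s, 0)) (by fun_prop) (y N x₀)
    (fun s => by rw [hL]; simp) 0 1
  have e1 : L (0, 1) = L (1, 1) := exp_const (fun s : I => L (s, 1)) (by fun_prop) (y N x₀)
    (fun s => by rw [hL]; simp) 0 1
  have : Complex.exp (L (0, 1)) = Complex.exp (L (0, 0)) := by rw [hL, hL]; simp
  obtain ⟨m, hm⟩ := Complex.exp_eq_exp_iff_exists_int.1 this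
  have key : ∀ s : I, ∀ δ : Path x₀ x₀, (∀ t, F (s, t) = δ t) →
      L (s, 1) - L (s, 0) = 2 * Real.pi * Complex.I * m →
      IsIdx d y V δ N ((m : ℚ) / (d : ℚ) ^ N) := by
    intro s δ hδ hs
    refine ⟨fun t => by rw [← hδ]; exact hN N le_rfl _,
      ⟨fun t => L (s, t), by fun_prop⟩, fun t => by simp [hL, hδ], ?_⟩
    simp only [ContinuousMap.coe_mk]
    rw [hs]; push_cast; field_simp
  have k0 := key 0 γ (fun t => by simp) (by rw [hm]; ring)
  have k1 := key 1 γ' (fun t => by simp) (by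
    rw [← e0, ← e1, hm]; ring)
  rw [h.unique hd hy hVm hy0 hyd k0, h'.unique hd hy hVm hy0 hyd k1]

lemma IsIdx.trans
    (hy : ∀ n, Continuous (y n))
    (hVm : ∀ n, V n ⊆ V (n + 1))
    (hy0 : ∀ n, ∀ x ∈ V n, y n x ≠ 0)
    (hyd : ∀ n, ∀ x ∈ V n, y (n + 1) x / (y n x) ^ d ∈ Complex.slitPlane)
    {γ γ' : Path x₀ x₀} {n m : ℕ} {q q' : ℚ} (h : IsIdx d y V γ n q)
    (h' : IsIdx d y V γ' m q') : IsIdx d y V (γ.trans γ') (max n m) (q + q') := by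
  obtain ⟨hγ, l, hl, e⟩ := h.mono hy hVm hy0 hyd (le_max_left n m)
  obtain ⟨hγ', l', hl', e'⟩ := h'.mono hy hVm hy0 hyd (le_max_right n m)
  let P : Path (l 0) (l 1) := ⟨l, rfl, rfl⟩
  let P' : Path (l 1) (l' 1 + (l 1 - l' 0)) :=
    ⟨⟨fun t => l' t + (l 1 - l' 0), by fun_prop⟩, by simp, by simp⟩
  have hP : ∀ t, Complex.exp (P t) = y (max n m) (γ t) := hl
  have hP' : ∀ t, Complex.exp (P' t) = y (max n m) (γ' t) := by
    intro t
    have : Complex.exp (l 1) = Complex.exp (l' 0) := by rw [hl, hl']; simp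
    change Complex.exp (l' t + (l 1 - l' 0)) = _
    rw [Complex.exp_add, Complex.exp_sub, this, div_self (Complex.exp_ne_zero _), hl', mul_one]
  refine ⟨fun t => ?_, (P.trans P').toContinuousMap, fun t => ?_, ?_⟩
  · rw [Path.trans_apply]; split_ifs
    · exact hγ _
    · exact hγ' _
  · change Complex.exp ((P.trans P') t) = _
    rw [Path.trans_apply, Path.trans_apply]; split_ifs
    · exact hP _
    · exact hP' _
  · change (P.trans P') 1 - (P.trans P') 0 = _
    rw [Path.source, Path.target]; push_cast
    linear_combination e + e'

theorem abstract_main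
    (hd : 2 ≤ d)
    (hy : ∀ n, Continuous (y n))
    (hVo : ∀ n, IsOpen (V n))
    (hVm : ∀ n, V n ⊆ V (n + 1))
    (hVc : ∀ x, ∃ n, x ∈ V n)
    (hy0 : ∀ n, ∀ x ∈ V n, y n x ≠ 0)
    (hyd : ∀ n, ∀ x ∈ V n, y (n + 1) x / (y n x) ^ d ∈ Complex.slitPlane)
    {S : AddSubgroup ℚ}
    (hS : ∀ q : ℚ, q ∈ S ↔ ∃ (m : ℤ) (n : ℕ), q = (m : ℚ) / (d : ℚ) ^ n)
    (hinj : ∀ γ : Path x₀ x₀, ∃ N, ∀ n ≥ N, (∀ t, γ t ∈ V n) → ∀ l : C(I, ℂ),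
      (∀ t, Complex.exp (l t) = y n (γ t)) → l 1 = l 0 → γ.Homotopic (Path.refl x₀))
    (hsurj : ∃ N, ∀ n ≥ N, ∀ m : ℤ, ∃ γ : Path x₀ x₀, (∀ t, γ t ∈ V n) ∧ ∃ l : C(I, ℂ),
      (∀ t, Complex.exp (l t) = y n (γ t)) ∧ l 1 - l 0 = 2 * Real.pi * Complex.I * m) :
    Nonempty (FundamentalGroup X x₀ ≃* Multiplicative S) := by
  choose idx lev hidx using fun γ : Path x₀ x₀ => IsIdx.exists hd hy hVo hVm hVc hy0 hyd hS γ
  let Φ : FundamentalGroup X x₀ → Multiplicative S := fun g =>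
    Multiplicative.ofAdd (Quotient.lift idx (fun γ γ' hh => Subtype.ext
      ((hidx γ).homotopic hd hy hVo hVm hVc hy0 hyd (hidx γ') hh))
      (FundamentalGroup.toPath g))
  have hΦ : ∀ γ : Path x₀ x₀, Φ (FundamentalGroup.fromPath (Path.Homotopic.Quotient.mk γ)) =
    Multiplicative.ofAdd (idx γ) := fun γ => rfl
  have hmul : ∀ g h, Φ (g * h) = Φ g * Φ h := by
    intro g h
    induction g using Path.Homotopic.Quotient.ind with | mk γ =>
    induction h using Path.Homotopic.Quotient.ind with | mk γ' =>
    have e : (FundamentalGroup.fromPath (Path.Homotopic.Quotient.mk γ) *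
      FundamentalGroup.fromPath (Path.Homotopic.Quotient.mk γ') : FundamentalGroup X x₀) =
      FundamentalGroup.fromPath (Path.Homotopic.Quotient.mk (γ'.trans γ)) := rfl
    change Φ (FundamentalGroup.fromPath (Path.Homotopic.Quotient.mk γ) *
      FundamentalGroup.fromPath (Path.Homotopic.Quotient.mk γ')) =
      Φ (FundamentalGroup.fromPath (Path.Homotopic.Quotient.mk γ)) *
      Φ (FundamentalGroup.fromPath (Path.Homotopic.Quotient.mk γ'))
    rw [e, hΦ, hΦ, hΦ, ← ofAdd_add]
    congr 1
    apply Subtype.ext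
    rw [(hidx (γ'.trans γ)).unique hd hy hVm hy0 hyd
      ((hidx γ').trans hy hVm hy0 hyd (hidx γ)), add_comm]
    rfl
  let Φh : FundamentalGroup X x₀ →* Multiplicative S := MonoidHom.mk' Φ hmul
  refine ⟨MulEquiv.ofBijective Φh ⟨?_, ?_⟩⟩
  · rw [injective_iff_map_eq_one]
    intro g hg
    induction g using Path.Homotopic.Quotient.ind with | mk γ =>
    have h0 : idx γ = 0 := hg
    obtain ⟨N, hN⟩ := hinj γ
    obtain ⟨hV, l, hl, e⟩ := (hidx γ).mono hy hVm hy0 hyd (le_max_left _ N)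
    have := hN _ (le_max_right _ _) hV l hl (by
      rw [h0] at e
      simpa [sub_eq_zero] using e)
    exact Path.Homotopic.Quotient.eq.2 this
  · intro q
    obtain ⟨q, rfl⟩ := Multiplicative.ofAdd.surjective q
    obtain ⟨m, k, hq⟩ := (hS _).1 q.2
    obtain ⟨N, hN⟩ := hsurj
    obtain ⟨γ, hV, l, hl, e⟩ := hN _ (le_max_left N k) (m * d ^ (max N k - k))
    refine ⟨FundamentalGroup.fromPath (Path.Homotopic.Quotient.mk γ), ?_⟩
    change Φ _ = _
    rw [hΦ]
    congr 1
    apply Subtype.ext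
    have hd0 : (d : ℂ) ≠ 0 := by exact_mod_cast (by omega : d ≠ 0)
    refine (hidx γ).unique hd hy hVm hy0 hyd (n := lev γ) (m := max N k) ⟨hV, l, hl, ?_⟩
    rw [e, hq]
    have : (d : ℂ) ^ (max N k) = d ^ (max N k - k) * d ^ k := by
      rw [← pow_add, Nat.sub_add_cancel (le_max_right _ _)]
    rw [this]
    push_cast
    field_simp

end abs

section henon

lemma poly_step (d : ℕ) (hd : 2 ≤ d) (a : ℂ) (p : Polynomial ℂ) (hpm : p.Monic)
    (hpd : p.natDegree = d) : ∃ R : ℝ, 4 ≤ R ∧ ∀ x y : ℂ, R < ‖y‖ → ‖x‖ < ‖y‖ →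
      ‖p.eval y - a * x - y ^ d‖ ≤ 1 / 2 * ‖y‖ ^ d := by
  set C : ℝ := ∑ i ∈ Finset.range d, ‖p.coeff i‖ + ‖a‖ with hC
  refine ⟨max 4 (2 * C), le_max_left _ _, fun x y hy hx => ?_⟩
  have h4 : 4 < ‖y‖ := lt_of_le_of_lt (le_max_left _ _) hy
  have h2C : 2 * C < ‖y‖ := lt_of_le_of_lt (le_max_right _ _) hy
  have hev : p.eval y = ∑ i ∈ Finset.range d, p.coeff i * y ^ i + y ^ d := by
    rw [Polynomial.eval_eq_sum_range, hpd, Finset.sum_range_succ]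
    have : p.coeff d = 1 := by rw [← hpd]; exact hpm
    rw [this, one_mul]
  have h1 : ‖p.eval y - a * x - y ^ d‖ ≤ C * ‖y‖ ^ (d - 1) := by
    have : p.eval y - a * x - y ^ d = ∑ i ∈ Finset.range d, p.coeff i * y ^ i - a * x := by
      rw [hev]; ring
    rw [this, hC, add_mul, Finset.sum_mul]
    refine (norm_sub_le _ _).trans (add_le_add ((norm_sum_le _ _).trans
      (Finset.sum_le_sum fun i hi => ?_)) ?_)
    · rw [norm_mul, norm_pow]
      refine mul_le_mul_of_nonneg_left (pow_le_pow_right₀ (by linarith) ?_) (norm_nonneg _)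
      have := Finset.mem_range.1 hi; omega
    · rw [norm_mul]
      refine mul_le_mul_of_nonneg_left (hx.le.trans ?_) (norm_nonneg _)
      exact le_self_pow₀ (by linarith) (by omega)
  have h3 : ‖y‖ ^ d = ‖y‖ * ‖y‖ ^ (d - 1) := by
    rw [← pow_succ']; congr 1; omega
  rw [h3]
  have : 0 ≤ ‖y‖ ^ (d - 1) := by positivity
  nlinarith

variable {d : ℕ} {R : ℝ} {H : ℂ × ℂ → ℂ × ℂ} {G : ℂ × ℂ → ℝ}

/-- The filtration set. -/
def VP (R : ℝ) : Set (ℂ × ℂ) := {z | R < ‖z.2‖ ∧ ‖z.1‖ < ‖z.2‖}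

lemma isOpen_VP (R : ℝ) : IsOpen (VP R) := by
  have h1 : IsOpen {z : ℂ × ℂ | R < ‖z.2‖} := isOpen_lt continuous_const (by fun_prop)
  have h2 : IsOpen {z : ℂ × ℂ | ‖z.1‖ < ‖z.2‖} := isOpen_lt (by fun_prop) (by fun_prop)
  exact h1.inter h2

lemma VP_inv
    (hd : 2 ≤ d)
    (hR : 4 ≤ R)
    (hH1 : ∀ z, (H z).1 = z.2)
    (hstep : ∀ z : ℂ × ℂ, R < ‖z.2‖ → ‖z.1‖ < ‖z.2‖ →
      ‖(H z).2 - z.2 ^ d‖ ≤ 1 / 2 * ‖z.2‖ ^ d)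
    {z : ℂ × ℂ} (hz : z ∈ VP R) : H z ∈ VP R := by
  obtain ⟨h1, h2⟩ := hz
  have h := hstep z h1 h2
  have h3 : ‖z.2 ^ d‖ - ‖(H z).2‖ ≤ ‖(H z).2 - z.2 ^ d‖ := by
    rw [norm_sub_rev]; exact norm_sub_norm_le _ _
  rw [norm_pow] at h3
  have h4 : ‖z.2‖ ^ 2 ≤ ‖z.2‖ ^ d := pow_le_pow_right₀ (by linarith) hd
  have h5 : ‖z.2‖ < ‖(H z).2‖ := by nlinarith
  exact ⟨h1.trans h5, by rw [hH1]; exact h5⟩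

lemma VP_iter
    (hd : 2 ≤ d)
    (hR : 4 ≤ R)
    (hH1 : ∀ z, (H z).1 = z.2)
    (hstep : ∀ z : ℂ × ℂ, R < ‖z.2‖ → ‖z.1‖ < ‖z.2‖ →
      ‖(H z).2 - z.2 ^ d‖ ≤ 1 / 2 * ‖z.2‖ ^ d)
    {z : ℂ × ℂ} (hz : z ∈ VP R) (n : ℕ) : H^[n] z ∈ VP R := by
  induction n with
  | zero => exact hz
  | succ n ih => rw [Function.iterate_succ_apply']; exact VP_inv hd hR hH1 hstep ih

lemma log_step
    (hR : 4 ≤ R)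
    (hstep : ∀ z : ℂ × ℂ, R < ‖z.2‖ → ‖z.1‖ < ‖z.2‖ →
      ‖(H z).2 - z.2 ^ d‖ ≤ 1 / 2 * ‖z.2‖ ^ d)
    {z : ℂ × ℂ} (hz : z ∈ VP R) :
    |Real.log ‖(H z).2‖ - d * Real.log ‖z.2‖| ≤ Real.log 2 := by
  obtain ⟨h1, h2⟩ := hz
  have h := hstep z h1 h2
  have h3 : ‖z.2 ^ d‖ - ‖(H z).2‖ ≤ ‖(H z).2 - z.2 ^ d‖ := by
    rw [norm_sub_rev]; exact norm_sub_norm_le _ _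
  have h4 : ‖(H z).2‖ - ‖z.2 ^ d‖ ≤ ‖(H z).2 - z.2 ^ d‖ := norm_sub_norm_le _ _
  rw [norm_pow] at h3 h4
  have hp : 0 < ‖z.2‖ ^ d := pow_pos (by linarith) _
  have hq : 0 < ‖(H z).2‖ := by linarith
  rw [← Real.log_pow, abs_le]
  constructor
  · have := Real.log_le_log hp (by linarith : ‖z.2‖ ^ d ≤ 2 * ‖(H z).2‖)
    rw [Real.log_mul (by norm_num) hq.ne'] at this
    linarith
  · have := Real.log_le_log hq (by linarith : ‖(H z).2‖ ≤ 2 * ‖z.2‖ ^ d)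
    rw [Real.log_mul (by norm_num) hp.ne'] at this
    linarith

lemma log_iter
    (hd : 2 ≤ d)
    (hR : 4 ≤ R)
    (hH1 : ∀ z, (H z).1 = z.2)
    (hstep : ∀ z : ℂ × ℂ, R < ‖z.2‖ → ‖z.1‖ < ‖z.2‖ →
      ‖(H z).2 - z.2 ^ d‖ ≤ 1 / 2 * ‖z.2‖ ^ d)
    {z : ℂ × ℂ} (hz : z ∈ VP R) (n : ℕ) :
    |Real.log ‖(H^[n] z).2‖ - d ^ n * Real.log ‖z.2‖| ≤ (d ^ n - 1) * Real.log 2 := by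
  induction n with
  | zero => simp
  | succ n ih =>
    have hs := log_step hR hstep (VP_iter hd hR hH1 hstep hz n)
    rw [← Function.iterate_succ_apply' H] at hs
    have hd' : (2 : ℝ) ≤ d := by exact_mod_cast hd
    have hl : 0 < Real.log 2 := Real.log_pos (by norm_num)
    have h2 : |(d : ℝ) * (Real.log ‖(H^[n] z).2‖ - d ^ n * Real.log ‖z.2‖)| ≤
        d * ((d ^ n - 1) * Real.log 2) := by
      rw [abs_mul, abs_of_nonneg (by linarith : (0 : ℝ) ≤ d)]
      exact mul_le_mul_of_nonneg_left ih (by linarith)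
    have h3 := abs_add_le (Real.log ‖(H^[n + 1] z).2‖ - d * Real.log ‖(H^[n] z).2‖)
      ((d : ℝ) * (Real.log ‖(H^[n] z).2‖ - d ^ n * Real.log ‖z.2‖))
    have h4 : Real.log ‖(H^[n + 1] z).2‖ - d * Real.log ‖(H^[n] z).2‖ +
      (d : ℝ) * (Real.log ‖(H^[n] z).2‖ - d ^ n * Real.log ‖z.2‖) =
      Real.log ‖(H^[n + 1] z).2‖ - d ^ (n + 1) * Real.log ‖z.2‖ := by ring
    rw [h4] at h3
    have h5 : (d : ℝ) * ((d ^ n - 1) * Real.log 2) = (d ^ (n + 1) - d) * Real.log 2 := by ring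
    nlinarith

lemma G_bound
    (hd : 2 ≤ d)
    (hR : 4 ≤ R)
    (hH1 : ∀ z, (H z).1 = z.2)
    (hstep : ∀ z : ℂ × ℂ, R < ‖z.2‖ → ‖z.1‖ < ‖z.2‖ →
      ‖(H z).2 - z.2 ^ d‖ ≤ 1 / 2 * ‖z.2‖ ^ d)
    (hGlim : ∀ z : ℂ × ℂ,
      Tendsto (fun n : ℕ => Real.log (max ‖H^[n] z‖ 1) / (d : ℝ) ^ n) atTop (𝓝 (G z)))
    {z : ℂ × ℂ} (hz : z ∈ VP R) : |G z - Real.log ‖z.2‖| ≤ Real.log 2 := by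
  have hl : 0 < Real.log 2 := Real.log_pos (by norm_num)
  refine le_of_tendsto ((hGlim z).sub_const _).abs (Eventually.of_forall fun n => ?_)
  obtain ⟨h1, h2⟩ := VP_iter hd hR hH1 hstep hz n
  have hm : max ‖H^[n] z‖ 1 = ‖(H^[n] z).2‖ := by
    rw [Prod.norm_def, max_eq_right h2.le, max_eq_left (by linarith)]
  have hb := log_iter hd hR hH1 hstep hz n
  have hp : (0 : ℝ) < d ^ n := pow_pos (by exact_mod_cast (by omega : 0 < d)) n
  rw [hm]
  have : Real.log ‖(H^[n] z).2‖ / (d : ℝ) ^ n - Real.log ‖z.2‖ =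
      (Real.log ‖(H^[n] z).2‖ - d ^ n * Real.log ‖z.2‖) / d ^ n := by field_simp
  rw [this, abs_div, abs_of_pos hp, div_le_iff₀ hp]
  nlinarith

lemma G_H
    (hd : 2 ≤ d)
    (hGlim : ∀ z : ℂ × ℂ,
      Tendsto (fun n : ℕ => Real.log (max ‖H^[n] z‖ 1) / (d : ℝ) ^ n) atTop (𝓝 (G z)))
    (z : ℂ × ℂ) : G (H z) = d * G z := by
  have h1 := (hGlim (H z))
  have h2 := ((tendsto_add_atTop_iff_nat 1).2 (hGlim z)).const_mul (d : ℝ)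
  refine tendsto_nhds_unique h1 (h2.congr fun n => ?_)
  have hd0 : (d : ℝ) ≠ 0 := by exact_mod_cast (by omega : d ≠ 0)
  rw [Function.iterate_succ_apply]
  field_simp
  ring

lemma G_iter
    (hd : 2 ≤ d)
    (hGlim : ∀ z : ℂ × ℂ,
      Tendsto (fun n : ℕ => Real.log (max ‖H^[n] z‖ 1) / (d : ℝ) ^ n) atTop (𝓝 (G z)))
    (z : ℂ × ℂ) (n : ℕ) : G (H^[n] z) = d ^ n * G z := by
  induction n with
  | zero => simp
  | succ n ih => rw [Function.iterate_succ_apply', G_H hd hGlim, ih]; ring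

lemma exists_VP
    (hd : 2 ≤ d)
    (hR : 4 ≤ R)
    (hH1 : ∀ z, (H z).1 = z.2)
    (hGlim : ∀ z : ℂ × ℂ,
      Tendsto (fun n : ℕ => Real.log (max ‖H^[n] z‖ 1) / (d : ℝ) ^ n) atTop (𝓝 (G z)))
    {z : ℂ × ℂ} (hz : 0 < G z) : ∃ n, H^[n] z ∈ VP R := by
  by_contra! hcon
  set B := max R ‖z‖ with hB
  have hb : ∀ n, ‖H^[n] z‖ ≤ B := by
    intro n
    induction n with
    | zero => exact le_max_right _ _
    | succ n ih =>
      have h := hcon (n + 1)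
      simp only [VP, mem_ofPred_eq, not_and_or, not_lt] at h
      have h1 : ‖(H^[n + 1] z).1‖ ≤ B := by
        rw [Function.iterate_succ_apply', hH1]
        exact (norm_snd_le _).trans ih
      rw [Prod.norm_def]
      refine max_le h1 ?_
      rcases h with h | h
      · exact h.trans (le_max_left _ _)
      · exact h.trans h1
  have hB1 : 1 ≤ B := le_trans (by linarith) (le_max_left R ‖z‖)
  have hd1 : (1 : ℝ) < d := by exact_mod_cast (by omega : 1 < d)
  have hlim : Tendsto (fun n : ℕ => Real.log B / (d : ℝ) ^ n) atTop (𝓝 0) :=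
    tendsto_const_nhds.div_atTop (tendsto_pow_atTop_atTop_of_one_lt hd1)
  have := le_of_tendsto_of_tendsto' (hGlim z) hlim (fun n => by
    refine div_le_div_of_nonneg_right ?_ (by positivity)
    exact Real.log_le_log (by positivity) (max_le (hb n) hB1))
  linarith

lemma exists_pow_gt
    (hd : 2 ≤ d)
    {M c : ℝ} (h : M < c) (K : ℝ) : ∃ N : ℕ, ∀ n ≥ N, (d : ℝ) ^ n * M + K < d ^ n * c := by
  have hd1 : (1 : ℝ) < d := by exact_mod_cast (by omega : 1 < d)
  obtain ⟨N, hN⟩ := pow_unbounded_of_one_lt (K / (c - M)) hd1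
  refine ⟨N, fun n hn => ?_⟩
  have := hN.trans_le (pow_le_pow_right₀ hd1.le hn)
  rw [div_lt_iff₀ (by linarith)] at this
  linarith

/-- Parametrization of the filtration set by logarithmic coordinates. -/
def E (u l : ℂ) : ℂ × ℂ := (u * Complex.exp l, Complex.exp l)

lemma E_mem {u l : ℂ} (hR : 4 ≤ R) (hu : ‖u‖ < 1) (hl : Real.log R < l.re) : E u l ∈ VP R := by
  have hn : ‖Complex.exp l‖ = Real.exp l.re := Complex.norm_exp l
  have h1 : R < ‖Complex.exp l‖ := by
    rw [hn]; exact (Real.log_lt_iff_lt_exp (by linarith)).1 hl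
  refine ⟨h1, ?_⟩
  simp only [E, norm_mul]
  nlinarith

lemma E_of_mem {z : ℂ × ℂ} (hR : 4 ≤ R) (hz : z ∈ VP R) {l : ℂ} (hl : Complex.exp l = z.2) :
    ‖z.1 / z.2‖ < 1 ∧ Real.log R < l.re ∧ l.re = Real.log ‖z.2‖ ∧ E (z.1 / z.2) l = z := by
  obtain ⟨h1, h2⟩ := hz
  have hp : 0 < ‖z.2‖ := by linarith
  have h3 : l.re = Real.log ‖z.2‖ := by rw [← hl, Complex.norm_exp, Real.log_exp]
  refine ⟨by rw [norm_div, div_lt_one hp]; exact h2, ?_, h3, ?_⟩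
  · rw [h3]; exact Real.log_lt_log (by linarith) h1
  · have : z.2 ≠ 0 := norm_pos_iff.1 hp
    apply Prod.ext
    · simp only [E, hl]; field_simp
    · exact hl

lemma E_G
    (hd : 2 ≤ d)
    (hR : 4 ≤ R)
    (hH1 : ∀ z, (H z).1 = z.2)
    (hstep : ∀ z : ℂ × ℂ, R < ‖z.2‖ → ‖z.1‖ < ‖z.2‖ →
      ‖(H z).2 - z.2 ^ d‖ ≤ 1 / 2 * ‖z.2‖ ^ d)
    (hGlim : ∀ z : ℂ × ℂ,
      Tendsto (fun n : ℕ => Real.log (max ‖H^[n] z‖ 1) / (d : ℝ) ^ n) atTop (𝓝 (G z)))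
    {u l : ℂ} (hu : ‖u‖ < 1) (hl : Real.log R < l.re) {c : ℝ} (hc : l.re + Real.log 2 < c) :
    0 < G (E u l) ∧ G (E u l) < c := by
  have hm := E_mem hR hu hl
  have hb := abs_le.1 (G_bound hd hR hH1 hstep hGlim hm)
  have : Real.log ‖(E u l).2‖ = l.re := by simp [E, Complex.norm_exp]
  rw [this] at hb
  have h2 : Real.log 2 < Real.log R := Real.log_lt_log (by norm_num) (by linarith)
  constructor <;> linarith [hb.1, hb.2]

theorem henon_main
    (hd : 2 ≤ d)
    (hR : 4 ≤ R)
    (hH1 : ∀ z, (H z).1 = z.2)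
    (hstep : ∀ z : ℂ × ℂ, R < ‖z.2‖ → ‖z.1‖ < ‖z.2‖ →
      ‖(H z).2 - z.2 ^ d‖ ≤ 1 / 2 * ‖z.2‖ ^ d)
    (hGlim : ∀ z : ℂ × ℂ,
      Tendsto (fun n : ℕ => Real.log (max ‖H^[n] z‖ 1) / (d : ℝ) ^ n) atTop (𝓝 (G z)))
    (hHc : Continuous H) (J : ℂ × ℂ → ℂ × ℂ) (hJc : Continuous J)
    (hHJ : ∀ z, H (J z) = z) (hJH : ∀ z, J (H z) = z)
    (hGcont : Continuous G)
    (S : AddSubgroup ℚ)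
    (hS : ∀ q : ℚ, q ∈ S ↔ ∃ (m : ℤ) (n : ℕ), q = (m : ℚ) / (d : ℚ) ^ n)
    (c : ℝ)
    (z₀ : ℂ × ℂ) (hz₀ : 0 < G z₀ ∧ G z₀ < c) :
    Nonempty
      (FundamentalGroup {z : ℂ × ℂ // 0 < G z ∧ G z < c} ⟨z₀, hz₀⟩ ≃*
        Multiplicative S) := by
  have hHn : ∀ n, Continuous (H^[n]) := fun n => hHc.iterate n
  have hJn : ∀ n, Continuous (J^[n]) := fun n => hJc.iterate n
  have hJHn : ∀ n z, J^[n] (H^[n] z) = z := fun n => (Function.LeftInverse.iterate hJH n)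
  have hHJn : ∀ n z, H^[n] (J^[n] z) = z := fun n => (Function.LeftInverse.iterate hHJ n)
  have hpow : ∀ n : ℕ, (0 : ℝ) < d ^ n :=
    fun n => pow_pos (by exact_mod_cast (by omega : 0 < d)) n
  -- points obtained by pulling back
  have hpull : ∀ (n : ℕ) (w : ℂ × ℂ), 0 < G w ∧ G w < d ^ n * c →
      0 < G (J^[n] w) ∧ G (J^[n] w) < c := by
    intro n w ⟨h1, h2⟩
    have := G_iter hd hGlim (J^[n] w) n
    rw [hHJn] at this
    rw [this] at h1 h2
    exact ⟨(pos_iff_pos_of_mul_pos h1).1 (hpow n), lt_of_mul_lt_mul_left h2 (hpow n).le⟩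
  -- pulled-back parametrization bound
  have hlog : ∀ (n : ℕ) (z : ℂ × ℂ), H^[n] z ∈ VP R →
      Real.log ‖(H^[n] z).2‖ ≤ d ^ n * G z + Real.log 2 := by
    intro n z hz
    have hb := abs_le.1 (G_bound hd hR hH1 hstep hGlim hz)
    rw [G_iter hd hGlim] at hb
    linarith [hb.1]
  refine abstract_main (d := d) hd (X := {z : ℂ × ℂ // 0 < G z ∧ G z < c})
    (y := fun n z => (H^[n] z.1).2) (V := fun n => {z | H^[n] z.1 ∈ VP R})
    (fun n => ?_) (fun n => ?_) (fun n => ?_) (fun z => ?_) (fun n z hz => ?_) (fun n z hz => ?_)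
    hS (fun γ => ?_) ?_
  · have := hHn n; fun_prop
  · exact (isOpen_VP R).preimage ((hHn n).comp continuous_subtype_val)
  · intro z hz
    simp only [mem_ofPred_eq, Function.iterate_succ_apply'] at hz ⊢
    exact VP_inv hd hR hH1 hstep hz
  · exact exists_VP hd hR hH1 hGlim z.2.1
  · have : R < ‖(H^[n] z.1).2‖ := hz.1
    exact norm_pos_iff.1 (by linarith)
  · have hz' : H^[n] z.1 ∈ VP R := hz
    have h := hstep _ hz'.1 hz'.2
    have hp : 0 < ‖(H^[n] z.1).2‖ := by linarith [hz'.1]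
    have hne : (H^[n] z.1).2 ^ d ≠ 0 := pow_ne_zero _ (norm_pos_iff.1 hp)
    rw [Function.iterate_succ_apply']
    apply Complex.ball_one_subset_slitPlane
    rw [mem_ball_iff_norm]
    have : (H (H^[n] z.1)).2 / (H^[n] z.1).2 ^ d - 1 =
      ((H (H^[n] z.1)).2 - (H^[n] z.1).2 ^ d) / (H^[n] z.1).2 ^ d := by field_simp
    rw [this, norm_div, div_lt_one (norm_pos_iff.2 hne), norm_pow]
    have : 0 < ‖(H^[n] z.1).2‖ ^ d := pow_pos hp _
    linarith
  · -- injectivity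
    obtain ⟨t₀, -, ht₀⟩ := isCompact_univ.exists_isMaxOn (univ_nonempty (α := I))
      (f := fun t => G (γ t).1) (by fun_prop)
    obtain ⟨N, hN⟩ := exists_pow_gt hd (γ t₀).2.2 (2 * Real.log 2)
    refine ⟨N, fun n hn hV l hl hl01 => ?_⟩
    have hn' := hN n hn
    let w : I → ℂ × ℂ := fun t => H^[n] (γ t).1
    have hwc : Continuous w := (hHn n).comp (by fun_prop)
    have hw : ∀ t, w t ∈ VP R := hV
    have hwl : ∀ t, Complex.exp (l t) = (w t).2 := hl
    let u : I → ℂ := fun t => (w t).1 / (w t).2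
    have huc : Continuous u := Continuous.div (by fun_prop) (by fun_prop)
      (fun t => norm_pos_iff.1 (by linarith [(hw t).1]))
    have hE := fun t => E_of_mem hR (hw t) (hwl t)
    have hup : ∀ t, (l t).re + Real.log 2 < d ^ n * c := by
      intro t
      have h1 := hlog n (γ t).1 (hw t)
      have h2 : G (γ t).1 ≤ G (γ t₀).1 := ht₀ (mem_univ t)
      have h3 := mul_le_mul_of_nonneg_left h2 (hpow n).le
      rw [(hE t).2.2.1]
      change Real.log ‖(H^[n] (γ t).1).2‖ + _ < _
      linarith
    have hw01 : w 1 = w 0 := by simp [w]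
    have hu01 : u 1 = u 0 := by simp only [u, hw01]
    -- the homotopy upstairs
    let us : I × I → ℂ := fun z => (1 - (z.1 : ℝ)) * u z.2 + (z.1 : ℝ) * u 0
    let ls : I × I → ℂ := fun z => (1 - (z.1 : ℝ)) * l z.2 + (z.1 : ℝ) * l 0
    have hus : Continuous us := by fun_prop
    have hls : Continuous ls := by fun_prop
    have hub : ∀ z, ‖us z‖ < 1 := by
      intro z
      have h0 := z.1.2.1
      have h1 := z.1.2.2
      have hcv := (convex_ball (0 : ℂ) 1) (x := u z.2) (mem_ball_zero_iff.2 (hE z.2).1)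
        (y := u 0) (mem_ball_zero_iff.2 (hE 0).1) (a := 1 - (z.1 : ℝ)) (b := z.1)
        (by linarith) h0 (by ring)
      simpa [us] using hcv
    have hlre : ∀ z, (ls z).re = (1 - (z.1 : ℝ)) * (l z.2).re + (z.1 : ℝ) * (l 0).re := by
      intro z
      have : ls z = ((1 - (z.1 : ℝ) : ℝ) : ℂ) * l z.2 + ((z.1 : ℝ) : ℂ) * l 0 := by
        simp [ls]
      rw [this, Complex.add_re, Complex.re_ofReal_mul, Complex.re_ofReal_mul]
    have hconv : ∀ z : I × I, (ls z).re ∈ Ioo (Real.log R) (d ^ n * c - Real.log 2) := by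
      intro z
      have h0 := z.1.2.1
      have h1 := z.1.2.2
      rw [hlre]
      exact (convex_Ioo (Real.log R) (d ^ n * c - Real.log 2)) (x := (l z.2).re)
        ⟨(hE z.2).2.1, by linarith [hup z.2]⟩ (y := (l 0).re)
        ⟨(hE 0).2.1, by linarith [hup 0]⟩ (a := 1 - (z.1 : ℝ)) (b := z.1)
        (by linarith) h0 (by ring)
    have hmem : ∀ z, 0 < G (J^[n] (E (us z) (ls z))) ∧ G (J^[n] (E (us z) (ls z))) < c := fun z =>
      hpull n _ (E_G hd hR hH1 hstep hGlim (hub z) (hconv z).1 (by linarith [(hconv z).2]))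
    have hJE : ∀ t, J^[n] (E (u t) (l t)) = (γ t).1 := by
      intro t
      have : E (u t) (l t) = w t := (hE t).2.2.2
      rw [this, hJHn]
    refine ⟨⟨⟨⟨fun z => ⟨J^[n] (E (us z) (ls z)), hmem z⟩, ?_⟩, ?_, ?_⟩, ?_⟩⟩
    · refine Continuous.subtype_mk ((hJn n).comp ?_) _
      unfold E; fun_prop
    · intro t
      apply Subtype.ext
      simpa [us, ls] using hJE t
    · intro t
      apply Subtype.ext
      simpa [us, ls] using hJE 0
    · rintro s t (rfl | rfl)
      · apply Subtype.ext
        have h1 : us (s, 0) = u 0 := by simp only [us]; ring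
        have h2 : ls (s, 0) = l 0 := by simp only [ls]; ring
        simp only [ContinuousMap.coe_mk, h1, h2]
        exact hJE 0
      · apply Subtype.ext
        have h1 : us (s, 1) = u 1 := by simp only [us, hu01]; ring
        have h2 : ls (s, 1) = l 1 := by simp only [ls, hl01]; ring
        simp only [ContinuousMap.coe_mk, h1, h2]
        exact hJE 1
  · -- surjectivity
    obtain ⟨N₁, hN₁⟩ := exists_VP hd hR hH1 hGlim hz₀.1
    obtain ⟨N₂, hN₂⟩ := exists_pow_gt hd hz₀.2 (2 * Real.log 2)
    refine ⟨max N₁ N₂, fun n hn m => ?_⟩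
    have hn₂ := hN₂ n ((le_max_right _ _).trans hn)
    have hz : H^[n] z₀ ∈ VP R := by
      have := VP_iter hd hR hH1 hstep hN₁ (n - N₁)
      rwa [← Function.iterate_add_apply, Nat.sub_add_cancel ((le_max_left _ _).trans hn)] at this
    set w := H^[n] z₀ with hwdef
    have hw0 : w.2 ≠ 0 := norm_pos_iff.1 (by linarith [hz.1])
    obtain ⟨h1, h2, h3, h4⟩ := E_of_mem hR hz (Complex.exp_log hw0)
    set l₀ := Complex.log w.2
    have hle := hlog n z₀ hz
    let l : C(I, ℂ) := ⟨fun t => l₀ + ((t : ℝ) : ℂ) * (m * (2 * Real.pi * Complex.I)), by fun_prop⟩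
    have hlre : ∀ t, (l t).re = l₀.re := by
      intro t; simp [l]
    have hlup : ∀ t, (l t).re + Real.log 2 < d ^ n * c := by
      intro t
      rw [hlre, h3]; linarith
    have hmem : ∀ t, 0 < G (J^[n] (E (w.1 / w.2) (l t))) ∧ G (J^[n] (E (w.1 / w.2) (l t))) < c :=
      fun t => hpull n _ (E_G hd hR hH1 hstep hGlim h1 (by rw [hlre]; exact h2) (hlup t))
    have hb : ∀ t, Complex.exp (l t) = Complex.exp l₀ →
        J^[n] (E (w.1 / w.2) (l t)) = z₀ := by
      intro t ht
      have : E (w.1 / w.2) (l t) = E (w.1 / w.2) l₀ := by simp only [E, ht]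
      rw [this, h4, hwdef, hJHn]
    refine ⟨⟨⟨fun t => ⟨J^[n] (E (w.1 / w.2) (l t)), hmem t⟩, ?_⟩, ?_, ?_⟩, fun t => ?_, l,
      fun t => ?_, ?_⟩
    · refine Continuous.subtype_mk ((hJn n).comp ?_) _
      unfold E; fun_prop
    · exact Subtype.ext (hb 0 (by simp [l]))
    · exact Subtype.ext (hb 1 (Complex.exp_eq_exp_iff_exists_int.2 ⟨m, by simp [l]⟩))
    · change H^[n] (J^[n] (E (w.1 / w.2) (l t))) ∈ VP R
      rw [hHJn]
      exact E_mem hR h1 (by rw [hlre]; exact h2)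
    · change _ = (H^[n] (J^[n] (E (w.1 / w.2) (l t)))).2
      rw [hHJn]; rfl
    · simp [l]; ring

end henon

end HenonPi1

/-- For every `c > 0` and every base point `z₀ ∈ Ω'_c`, the fundamental
group of the punctured Short ℂ², `Ω'_c = {0 < G⁺_H < c}` (with its subspace topology),
is isomorphic to the additive group `ℤ[1/d]` of rationals whose denominator is a power
of `d` (here given as the additive subgroup `S` of `ℚ`). -/
theorem stmt_10 (d : ℕ) (hd : 2 ≤ d) (a : ℂ) (ha : a ≠ 0)
    (p : Polynomial ℂ) (hpm : p.Monic) (hpd : p.natDegree = d)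
    (hpc : p.coeff (d - 1) = 0)
    (H : ℂ × ℂ → ℂ × ℂ) (hH : ∀ z : ℂ × ℂ, H z = (z.2, p.eval z.2 - a * z.1))
    (G : ℂ × ℂ → ℝ) (hGcont : Continuous G) (hGnonneg : ∀ z, 0 ≤ G z)
    (hGlim : ∀ z : ℂ × ℂ,
      Tendsto (fun n : ℕ => Real.log (max ‖H^[n] z‖ 1) / (d : ℝ) ^ n) atTop (𝓝 (G z)))
    (S : AddSubgroup ℚ)
    (hS : ∀ q : ℚ, q ∈ S ↔ ∃ (m : ℤ) (n : ℕ), q = (m : ℚ) / (d : ℚ) ^ n)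
    (c : ℝ) (hc : 0 < c)
    (z₀ : ℂ × ℂ) (hz₀ : 0 < G z₀ ∧ G z₀ < c) :
    Nonempty
      (FundamentalGroup {z : ℂ × ℂ // 0 < G z ∧ G z < c} ⟨z₀, hz₀⟩ ≃*
        Multiplicative S) := by
  obtain ⟨R, hR, hstep⟩ := HenonPi1.poly_step d hd a p hpm hpd
  have hHfun : H = fun z : ℂ × ℂ => (z.2, p.eval z.2 - a * z.1) := funext hH
  have hHc : Continuous H := by
    rw [hHfun]
    exact continuous_snd.prodMk ((p.continuous.comp continuous_snd).sub
      (continuous_const.mul continuous_fst))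
  refine HenonPi1.henon_main (d := d) (R := R) (H := H) (G := G) hd hR (fun z => by rw [hH])
    (fun z h1 h2 => by rw [hH]; exact hstep z.1 z.2 h1 h2) hGlim hHc
    (fun z => ((p.eval z.1 - z.2) / a, z.1)) ?_ (fun z => ?_) (fun z => ?_) hGcont S hS c z₀ hz₀
  · exact (((p.continuous.comp continuous_fst).sub continuous_snd).div_const a).prodMk
      continuous_fst
  · rw [hH]
    apply Prod.ext
    · rfl
    · simp only; field_simp; ring
  · rw [hH]
    apply Prod.ext
    · simp only; field_simp; ring
    · rfl
end
end
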